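/- arXiv:1203.3569 — 3 statements merged into one kernel-verified Lean document; each statement's English description precedes it below -/
import Mathlib

section
/- Let H(t,q,p) : ℝ × ℝ^d × ℝ^d → ℝ be a C² Hamiltonian satisfying: ‖d²H‖ ≤ M everywhere; ∂²_{pp} H ≥ m·Id in the sense of quadratic forms everywhere; and (m/2)|p|² − M ≤ H(t,q,p) ≤ (M/2)|p|² + M everywhere, with constants 0 < m ≤ M. Then every C¹ solution u(t,q) : (t₀,t₁) × ℝ^d → ℝ of the Hamilton–Jacobi equation (HJ) is locally C^{1,1}, i.e. its differential is locally Lipschitz on (t₀,t₁) × ℝ^d. -/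
open scoped RealInnerProductSpace NNReal
open Set Metric

section SecondDifference

variable {V : Type*} [NormedAddCommGroup V] [NormedSpace ℝ V]

/-- A lower bound on the second derivative in a direction bounds second differences below. -/
theorem le_secondDifference_of_le_fderiv_fderiv {f : V → ℝ} (hf : ContDiff ℝ 2 f) {w : V} {c : ℝ}
    (hc : ∀ x, c ≤ fderiv ℝ (fderiv ℝ f) x w w) (x : V) :
    c ≤ f (x + w) + f (x - w) - 2 * f x := by
  have hf1 : Differentiable ℝ f := hf.differentiable (by norm_num)
  have hf2 : Differentiable ℝ (fderiv ℝ f) :=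
    (hf.fderiv_right (m := 1) (by norm_num)).differentiable (by norm_num)
  have hline (s : ℝ) : HasDerivAt (fun s : ℝ => x + s • w) w s := by
    simpa using ((hasDerivAt_id s).smul_const w).const_add x
  have h1 (s : ℝ) : HasDerivAt (fun s : ℝ => f (x + s • w) - c / 2 * s ^ 2)
      (fderiv ℝ f (x + s • w) w - c * s) s := by
    have := ((hf1 (x + s • w)).hasFDerivAt.comp_hasDerivAt s (hline s)).sub
      ((hasDerivAt_pow 2 s).const_mul (c / 2))
    refine this.congr_deriv ?_
    norm_num
    ring
  have h2 (s : ℝ) : HasDerivAt (fun s : ℝ => fderiv ℝ f (x + s • w) w - c * s)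
      (fderiv ℝ (fderiv ℝ f) (x + s • w) w w - c) s := by
    have hdf : HasDerivAt (fun s : ℝ => fderiv ℝ f (x + s • w))
        (fderiv ℝ (fderiv ℝ f) (x + s • w) w) s :=
      (hf2 (x + s • w)).hasFDerivAt.comp_hasDerivAt s (hline s)
    have hlin : HasDerivAt (fun s : ℝ => c * s) c s := by
      simpa using (hasDerivAt_id s).const_mul c
    refine ((hdf.clm_apply (hasDerivAt_const s w)).sub hlin).congr_deriv ?_
    simp
  have hd1 := funext fun s => (h1 s).deriv
  have hconv : ConvexOn ℝ univ (fun s : ℝ => f (x + s • w) - c / 2 * s ^ 2) := by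
    refine convexOn_univ_of_deriv2_nonneg (fun s => (h1 s).differentiableAt) ?_ fun s => ?_
    · rw [hd1]
      exact fun s => (h2 s).differentiableAt
    · simp only [Function.iterate_succ, Function.iterate_zero, Function.comp_apply, id_eq]
      rw [hd1, (h2 s).deriv]
      linarith [hc (x + s • w)]
  have := hconv.2 (mem_univ 1) (mem_univ (-1)) (by norm_num : (0 : ℝ) ≤ 1 / 2)
    (by norm_num : (0 : ℝ) ≤ 1 / 2) (by norm_num)
  norm_num [← sub_eq_add_neg] at this
  linarith

/-- Taylor's inequality from a two-sided bound on second differences. -/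
theorem abs_sub_sub_le_of_abs_secondDifference_le {f : V → ℝ} {s : Set V} {C : ℝ} (hC : 0 ≤ C)
    (hs : Convex ℝ s) (x h : V) {f' : V →L[ℝ] ℝ} (hf : HasFDerivAt f f' x) (hx : x ∈ s)
    (hxh : x + h ∈ s) (hh : ‖h‖ ≤ 1)
    (hsd : ∀ y ∈ s, ∀ k : V, ‖k‖ ≤ 1 → |f (y + k) + f (y - k) - 2 * f y| ≤ C * ‖k‖ ^ 2) :
    |f (x + h) - f x - f' h| ≤ C * ‖h‖ ^ 2 := by
  set G : V → ℝ := fun k => f (x + k) - f x - f' k with hG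
  have hhalf : ∀ n : ℕ, |G ((1 / 2 : ℝ) ^ n • h)| ≤
      2 * |G ((1 / 2 : ℝ) ^ (n + 1) • h)| + C * (((1 / 2 : ℝ) ^ (n + 1)) ^ 2 * ‖h‖ ^ 2) := by
    intro n
    set k := (1 / 2 : ℝ) ^ (n + 1) • h with hk
    have hk2 : (1 / 2 : ℝ) ^ n • h = k + k := by
      rw [hk, ← add_smul]; congr 1; ring
    have hle1 : (1 / 2 : ℝ) ^ (n + 1) ≤ 1 := pow_le_one₀ (by norm_num) (by norm_num)
    have hnk : ‖k‖ = (1 / 2 : ℝ) ^ (n + 1) * ‖h‖ := by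
      rw [hk, norm_smul, Real.norm_of_nonneg (by positivity)]
    have hkn : ‖k‖ ≤ 1 := by
      rw [hnk]; exact mul_le_one₀ hle1 (norm_nonneg _) hh
    have hxk : x + k ∈ s := by
      have := hs.add_smul_sub_mem hx hxh (t := (1 / 2 : ℝ) ^ (n + 1))
        ⟨by positivity, hle1⟩
      simpa [hk] using this
    have := hsd (x + k) hxk k hkn
    have hid : G (k + k) = 2 * G k + (f (x + k + k) + f (x + k - k) - 2 * f (x + k)) := by
      simp only [hG, map_add, add_sub_cancel_right, add_assoc]; ring
    rw [hk2, hid]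
    refine (abs_add_le _ _).trans ?_
    rw [abs_mul, abs_two]
    rw [hnk, mul_pow] at this
    linarith
  have hiter : ∀ n : ℕ, |G h| ≤
      2 ^ n * |G ((1 / 2 : ℝ) ^ n • h)| + C * ‖h‖ ^ 2 * (1 - (1 / 2) ^ n) := by
    intro n
    induction n with
    | zero => simp
    | succ n ih =>
      have h2 := mul_le_mul_of_nonneg_left (hhalf n) (by positivity : (0 : ℝ) ≤ 2 ^ n)
      have e1 : (2 : ℝ) ^ n * (1 / 2) ^ n = 1 := by rw [← mul_pow]; norm_num
      have e2 : (2 : ℝ) ^ n * (C * (((1 / 2 : ℝ) ^ (n + 1)) ^ 2 * ‖h‖ ^ 2)) =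
          C * ‖h‖ ^ 2 * (1 / 4 * (1 / 2) ^ n) := by
        calc _ = C * ‖h‖ ^ 2 * (1 / 4 * (1 / 2) ^ n) * ((2 : ℝ) ^ n * (1 / 2) ^ n) := by ring
          _ = _ := by rw [e1, mul_one]
      have e3 : 0 ≤ C * ‖h‖ ^ 2 * (1 / 2) ^ n := by positivity
      rw [mul_add, e2] at h2
      rw [pow_succ (1 / 2 : ℝ) n] at *
      rw [pow_succ (2 : ℝ) n]
      linarith
  change |G h| ≤ _
  refine le_of_forall_pos_le_add fun ε hε => ?_
  have hlo := (hasFDerivAt_iff_isLittleO_nhds_zero.1 hf).def hε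
  have htend : Filter.Tendsto (fun n : ℕ => (1 / 2 : ℝ) ^ n • h) Filter.atTop (nhds 0) := by
    simpa using (tendsto_pow_atTop_nhds_zero_of_lt_one (by norm_num : (0 : ℝ) ≤ 1 / 2)
      (by norm_num)).smul_const h
  obtain ⟨n, hn⟩ := (htend.eventually hlo).exists
  have e1 : (2 : ℝ) ^ n * (1 / 2) ^ n = 1 := by rw [← mul_pow]; norm_num
  rw [Real.norm_eq_abs, norm_smul, Real.norm_of_nonneg (by positivity)] at hn
  have h1 := mul_le_mul_of_nonneg_left hn (by positivity : (0 : ℝ) ≤ 2 ^ n)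
  have h2 : (2 : ℝ) ^ n * (ε * ((1 / 2) ^ n * ‖h‖)) = ε * ‖h‖ := by
    calc _ = ε * ‖h‖ * ((2 : ℝ) ^ n * (1 / 2) ^ n) := by ring
      _ = _ := by rw [e1, mul_one]
  have h3 : 0 ≤ C * ‖h‖ ^ 2 * (1 / 2) ^ n := by positivity
  have h4 : ε * ‖h‖ ≤ ε := mul_le_of_le_one_right hε.le hh
  have := hiter n
  simp only [hG] at *
  linarith

/-- A function with bounded second differences on a ball has a Lipschitz differential near its
centre. -/
theorem norm_fderiv_sub_le_of_abs_secondDifference_le {f : V → ℝ} {f' : V → V →L[ℝ] ℝ} {q : V}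
    {C r : ℝ} (hC : 0 ≤ C) (hr : r ≤ 1) (hf : ∀ x, HasFDerivAt f (f' x) x)
    (hsd : ∀ y ∈ ball q r, ∀ k : V, ‖k‖ ≤ 1 →
      |f (y + k) + f (y - k) - 2 * f y| ≤ C * ‖k‖ ^ 2)
    {x y : V} (hx : x ∈ ball q (r / 4)) (hy : y ∈ ball q (r / 4)) :
    ‖f' y - f' x‖ ≤ 12 * C * ‖y - x‖ := by
  rcases eq_or_ne y x with rfl | hxy
  · simp
  have hpos : 0 < ‖y - x‖ := norm_pos_iff.2 (sub_ne_zero.2 hxy)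
  rw [mem_ball_iff_norm] at hx hy
  have hxy2 : ‖y - x‖ < r / 2 := by
    have := norm_sub_le (y - q) (x - q)
    rw [sub_sub_sub_cancel_right] at this
    linarith
  have hr0 : 0 < r := by linarith [norm_nonneg (x - q)]
  refine ContinuousLinearMap.opNorm_le_of_shell hpos (by positivity)
    (c := (2 : ℝ)) (by norm_num) fun k hk1 hk2 => ?_
  rw [Real.norm_ofNat] at hk1
  have taylor {a b : V} (ha : a ∈ ball q r) (hb : b ∈ ball q r) (hab : ‖b - a‖ ≤ 1) :
      |f b - f a - f' a (b - a)| ≤ C * ‖b - a‖ ^ 2 := by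
    simpa using abs_sub_sub_le_of_abs_secondDifference_le hC (convex_ball q r) a (b - a) (hf a) ha
      (by simpa using hb) hab hsd
  have hx' : x ∈ ball q r := by rw [mem_ball_iff_norm]; linarith
  have hy' : y ∈ ball q r := by rw [mem_ball_iff_norm]; linarith
  have hyk : y + k ∈ ball q r := by
    rw [mem_ball_iff_norm, add_sub_right_comm]
    linarith [norm_add_le (y - q) k]
  have hykx : ‖y + k - x‖ ≤ 2 * ‖y - x‖ := by
    rw [add_sub_right_comm]
    linarith [norm_add_le (y - x) k]
  have h1 := taylor hx' hy' (by linarith)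
  have h2 := taylor hx' hyk (by linarith)
  have h3 := taylor hy' hyk (by rw [add_sub_cancel_left]; linarith)
  have e2 : C * ‖y + k - x‖ ^ 2 ≤ C * (2 * ‖y - x‖) ^ 2 := by gcongr
  have e3 : C * ‖y + k - y‖ ^ 2 ≤ C * ‖y - x‖ ^ 2 := by
    rw [add_sub_cancel_left]; gcongr
  have hk3 : C * ‖y - x‖ * ‖y - x‖ ≤ C * ‖y - x‖ * (2 * ‖k‖) := by
    gcongr
    linarith
  have hid : (f' y - f' x) k = (f (y + k) - f x - f' x (y + k - x)) -
      (f (y + k) - f y - f' y (y + k - y)) - (f y - f x - f' x (y - x)) := by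
    rw [add_sub_cancel_left, add_sub_right_comm y k x, map_add, sub_apply]
    ring
  rw [hid, Real.norm_eq_abs]
  refine (abs_sub _ _).trans ((add_le_add_left (abs_sub _ _) _).trans ?_)
  nlinarith

end SecondDifference

section Hamiltonian

variable {E : Type*} [NormedAddCommGroup E] [InnerProductSpace ℝ E]

/-- A uniformly convex Hamiltonian with bounded Hessian has second differences bounded below. -/
theorem le_secondDifference_hamiltonian {H : ℝ → E → E → ℝ}
    (hH : ContDiff ℝ 2 (fun x : ℝ × E × E => H x.1 x.2.1 x.2.2)) {m M : ℝ}
    (hd2H : ∀ x : ℝ × E × E,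
      ‖iteratedFDeriv ℝ 2 (fun y : ℝ × E × E => H y.1 y.2.1 y.2.2) x‖ ≤ M)
    (hconv : ∀ (t : ℝ) (q p v : E),
      m * ‖v‖ ^ 2 ≤ iteratedFDeriv ℝ 2 (fun p' => H t q p') p ![v, v])
    (t : ℝ) (q p h k : E) :
    m * ‖k‖ ^ 2 - 2 * M * ‖h‖ * ‖k‖ - M * ‖h‖ ^ 2 ≤
      H t (q + h) (p + k) + H t (q - h) (p - k) - 2 * H t q p := by
  set F : ℝ × E × E → ℝ := fun x => H x.1 x.2.1 x.2.2 with hF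
  have hbound (x v w : ℝ × E × E) : |fderiv ℝ (fderiv ℝ F) x v w| ≤ M * (‖v‖ * ‖w‖) := by
    have := (iteratedFDeriv ℝ 2 F x).le_opNorm ![v, w]
    rw [iteratedFDeriv_two_apply] at this
    simp only [Fin.prod_univ_two, Matrix.cons_val_zero, Matrix.cons_val_one] at this
    exact this.trans (mul_le_mul_of_nonneg_right (hd2H x) (by positivity))
  have hpp (x : ℝ × E × E) :
      m * ‖k‖ ^ 2 ≤ fderiv ℝ (fderiv ℝ F) x ((0 : ℝ), (0 : E), k) ((0 : ℝ), (0 : E), k) := by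
    obtain ⟨s, y, r⟩ := x
    refine (hconv s y r k).trans_eq ?_
    set g : E →L[ℝ] ℝ × E × E :=
      (ContinuousLinearMap.inr ℝ ℝ (E × E)).comp (ContinuousLinearMap.inr ℝ E E) with hg
    have hcomp : (fun p' => H s y p') = (fun z => F ((s, y, 0) + z)) ∘ g := by
      ext p'; simp [hF, hg]
    have hshift : ContDiff ℝ 2 (fun z => F ((s, y, 0) + z)) :=
      hH.comp (contDiff_const.add contDiff_id)
    rw [hcomp, g.iteratedFDeriv_comp_right hshift r (i := 2) (by norm_num),
      iteratedFDeriv_comp_add_left, ContinuousMultilinearMap.compContinuousLinearMap_apply,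
      iteratedFDeriv_two_apply]
    simp [hg]
  have key := le_secondDifference_of_le_fderiv_fderiv hH (w := ((0 : ℝ), h, k))
    (c := m * ‖k‖ ^ 2 - 2 * M * ‖h‖ * ‖k‖ - M * ‖h‖ ^ 2) (fun x => ?_) (t, q, p)
  · simpa using key
  · have hw : ((0 : ℝ), h, k) = ((0 : ℝ), h, (0 : E)) + ((0 : ℝ), (0 : E), k) := by simp
    have n1 : ‖((0 : ℝ), h, (0 : E))‖ = ‖h‖ := by simp [Prod.norm_def]
    have n2 : ‖((0 : ℝ), (0 : E), k)‖ = ‖k‖ := by simp [Prod.norm_def]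
    have h1 := hbound x ((0 : ℝ), h, (0 : E)) ((0 : ℝ), h, (0 : E))
    have h2 := hbound x ((0 : ℝ), h, (0 : E)) ((0 : ℝ), (0 : E), k)
    have h3 := hbound x ((0 : ℝ), (0 : E), k) ((0 : ℝ), h, (0 : E))
    rw [n1] at h1
    rw [n1, n2] at h2 h3
    have h4 := hpp x
    rw [hw]
    simp only [map_add, add_apply]
    linarith [(abs_le.1 h1).1, (abs_le.1 h2).1, (abs_le.1 h3).1]

end Hamiltonian

section SecondDifferenceEstimate

variable {E : Type*} [NormedAddCommGroup E] [InnerProductSpace ℝ E]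

/-- The differential `-a dt + p dq`. -/
noncomputable def spacetimeForm (a : ℝ) (p : E) : ℝ × E →L[ℝ] ℝ :=
  (-a) • ContinuousLinearMap.fst ℝ ℝ E + (innerSL ℝ p).comp (ContinuousLinearMap.snd ℝ ℝ E)

@[simp] theorem spacetimeForm_apply (a : ℝ) (p : E) (v : ℝ × E) :
    spacetimeForm a p v = -a * v.1 + ⟪p, v.2⟫ := by
  simp [spacetimeForm]

theorem norm_spacetimeForm_sub_le (a b : ℝ) (p r : E) :
    ‖spacetimeForm a p - spacetimeForm b r‖ ≤ |a - b| + ‖p - r‖ := by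
  refine ContinuousLinearMap.opNorm_le_bound _ (by positivity) fun v => ?_
  have e : (spacetimeForm a p - spacetimeForm b r) v = -((a - b) * v.1) + ⟪p - r, v.2⟫ := by
    simp only [sub_apply, spacetimeForm_apply, inner_sub_left]; ring
  rw [e, add_mul]
  refine (norm_add_le _ _).trans (add_le_add ?_ ?_)
  · rw [norm_neg, norm_mul, Real.norm_eq_abs]
    gcongr
    exact norm_fst_le v
  · refine (norm_inner_le_norm _ _).trans ?_
    gcongr
    exact norm_snd_le v

theorem HasFDerivAt.space_section {u : ℝ × E → ℝ} {a t : ℝ} {p q : E}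
    (hu : HasFDerivAt u (spacetimeForm a p) (t, q)) :
    HasFDerivAt (fun y => u (t, y)) (innerSL ℝ p) q := by
  refine (hu.comp q (hasFDerivAt_prodMk_right t q)).congr_fderiv ?_
  ext v
  simp

theorem HasFDerivAt.time_section {u : ℝ × E → ℝ} {a t : ℝ} {p q : E}
    (hu : HasFDerivAt u (spacetimeForm a p) (t, q)) :
    HasDerivAt (fun τ => u (τ, q)) (-a) t := by
  have hline : HasDerivAt (fun τ : ℝ => (τ, q)) ((1 : ℝ), (0 : E)) t :=
    (hasDerivAt_id t).prodMk (hasDerivAt_const t q)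
  refine (hu.comp_hasDerivAt t hline).congr_deriv ?_
  simp

/-- The second difference of `u` in the space variable. -/
def spaceSecondDiff (u : ℝ × E → ℝ) (x : ℝ × E × E) : ℝ :=
  u (x.1, x.2.1 + x.2.2) + u (x.1, x.2.1 - x.2.2) - 2 * u (x.1, x.2.1)

/-- A cutoff, positive exactly when the first two components lie within distance `R` of
`(s₀, q₀)`. -/
def ballCutoff (R s₀ : ℝ) (q₀ : E) (x : ℝ × E × E) : ℝ :=
  R ^ 2 - (x.1 - s₀) ^ 2 - ‖x.2.1 - q₀‖ ^ 2

/-- The first order conditions at a maximum of the penalised second difference bound the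
penalisation. -/
theorem le_of_secondDifference_critical {H : E → E → ℝ} {m M K L B D σ : ℝ} (hL : 0 ≤ L)
    (hD : 0 ≤ D)
    (hH : ∀ q p h k : E, m * ‖k‖ ^ 2 - 2 * M * ‖h‖ * ‖k‖ - M * ‖h‖ ^ 2 ≤
      H (q + h) (p + k) + H (q - h) (p - k) - 2 * H q p)
    {q h w p₀ p₁ p₂ : E} (hlip : ∀ p p', ‖p‖ ≤ K → ‖p'‖ ≤ K → |H q p - H q p'| ≤ L * ‖p - p'‖)
    (hσ : |σ| = 1) (hB : 0 ≤ B) (hh : h ≠ 0) (h₀ : ‖p₀‖ ≤ K) (h₁ : ‖p₁‖ ≤ K) (h₂ : ‖p₂‖ ≤ K)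
    (hw : ‖w‖ ≤ 1) (hdiff : p₁ - p₂ = (2 * σ * B) • h)
    (hmid : p₁ + p₂ - (2 : ℝ) • p₀ = (2 * σ * D * ‖h‖ ^ 2) • w)
    (htime : H (q + h) p₁ + H (q - h) p₂ - 2 * H q p₀ ≤ 2 * D * ‖h‖ ^ 2) :
    m * B ^ 2 ≤ 2 * M * B + M + 2 * (1 + L) * D := by
  set c := (1 / 2 : ℝ) • (p₁ + p₂) with hc
  have e1 : c + (σ * B) • h = p₁ := by
    have : (σ * B) • h = (1 / 2 : ℝ) • (p₁ - p₂) := by rw [hdiff, smul_smul]; congr 1; ring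
    rw [this, hc]; module
  have e2 : c - (σ * B) • h = p₂ := by
    have : (σ * B) • h = (1 / 2 : ℝ) • (p₁ - p₂) := by rw [hdiff, smul_smul]; congr 1; ring
    rw [this, hc]; module
  have e3 : c - p₀ = (σ * D * ‖h‖ ^ 2) • w := by
    have : c - p₀ = (1 / 2 : ℝ) • (p₁ + p₂ - (2 : ℝ) • p₀) := by rw [hc]; module
    rw [this, hmid, smul_smul]; congr 1; ring
  have hcK : ‖c‖ ≤ K := by
    rw [hc, norm_smul]
    norm_num
    linarith [norm_add_le p₁ p₂]
  have hn3 : ‖c - p₀‖ ≤ D * ‖h‖ ^ 2 := by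
    rw [e3, norm_smul, norm_mul, norm_mul, Real.norm_eq_abs σ, hσ, one_mul,
      Real.norm_of_nonneg hD, Real.norm_of_nonneg (by positivity)]
    exact mul_le_of_le_one_right (by positivity) hw
  have hnk : ‖(σ * B) • h‖ = B * ‖h‖ := by
    rw [norm_smul, norm_mul, Real.norm_eq_abs σ, hσ, one_mul, Real.norm_of_nonneg hB]
  have hsec := hH q c h ((σ * B) • h)
  rw [e1, e2, hnk] at hsec
  have hcp := (abs_le.1 (hlip c p₀ hcK h₀)).1
  have hLn := mul_le_mul_of_nonneg_left hn3 hL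
  have hpos : 0 < ‖h‖ ^ 2 := by positivity
  refine le_of_mul_le_mul_right ?_ hpos
  nlinarith

/-- The first order conditions at a local maximum of the localised second difference. -/
theorem secondDiff_stationary {a : ℝ × E → ℝ} {u : ℝ × E → ℝ} {p : ℝ × E → E}
    {R s₀ σ δ B₀ t : ℝ} {q₀ q h : E}
    (hu : ∀ y, HasFDerivAt u (spacetimeForm (a (t, y)) (p (t, y))) (t, y))
    (hmax : IsLocalMax (fun z : ℝ × E × E =>
      ballCutoff R s₀ q₀ z * (σ * spaceSecondDiff u z - δ) - B₀ * ‖z.2.2‖ ^ 2) (t, q, h))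
    (τ : ℝ) (v k : E) :
    (-2 * (t - s₀) * τ - 2 * ⟪q - q₀, v⟫) * (σ * spaceSecondDiff u (t, q, h) - δ) +
      ballCutoff R s₀ q₀ (t, q, h) * (σ * ((-a (t, q + h) * τ + ⟪p (t, q + h), v + k⟫) +
        (-a (t, q - h) * τ + ⟪p (t, q - h), v - k⟫) - 2 * (-a (t, q) * τ + ⟪p (t, q), v⟫))) -
      B₀ * (2 * ⟪h, k⟫) = 0 := by
  have hlu (y v : E) : HasDerivAt (fun s : ℝ => u (t + s * τ, y + s • v))
      (-a (t, y) * τ + ⟪p (t, y), v⟫) 0 := by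
    have hline : HasDerivAt (fun s : ℝ => (t + s * τ, y + s • v)) (τ, v) 0 := by
      have h1 : HasDerivAt (fun s : ℝ => t + s * τ) τ 0 := by
        simpa using ((hasDerivAt_id (0 : ℝ)).mul_const τ).const_add t
      have h2 : HasDerivAt (fun s : ℝ => y + s • v) v 0 := by
        simpa using ((hasDerivAt_id (0 : ℝ)).smul_const v).const_add y
      exact h1.prodMk h2
    refine ((hu y).comp_hasDerivAt_of_eq 0 hline (by simp)).congr_deriv ?_
    simp
  have hlin (y v : E) : HasDerivAt (fun s : ℝ => y + s • v) v 0 := by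
    simpa using ((hasDerivAt_id (0 : ℝ)).smul_const v).const_add y
  have hline : HasDerivAt (fun s : ℝ => t - s₀ + s * τ) τ 0 := by
    simpa using ((hasDerivAt_id (0 : ℝ)).mul_const τ).const_add (t - s₀)
  have hdρ : HasDerivAt (fun s : ℝ => R ^ 2 - (t - s₀ + s * τ) ^ 2 - ‖q - q₀ + s • v‖ ^ 2)
      (-2 * (t - s₀) * τ - 2 * ⟪q - q₀, v⟫) 0 := by
    refine (((hline.pow 2).const_sub (R ^ 2)).sub (hlin (q - q₀) v).norm_sq).congr_deriv ?_
    simp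
  have hdΔ := (((hlu (q + h) (v + k)).add (hlu (q - h) (v - k))).sub
    ((hlu q v).const_mul 2)).const_mul σ |>.sub_const δ
  have hdG := (hdρ.mul hdΔ).sub ((hlin h k).norm_sq.const_mul B₀)
  have hloc : IsLocalMax ((fun z : ℝ × E × E =>
      ballCutoff R s₀ q₀ z * (σ * spaceSecondDiff u z - δ) - B₀ * ‖z.2.2‖ ^ 2) ∘
      fun s : ℝ => (t + s * τ, q + s • v, h + s • k)) 0 := by
    refine IsLocalMax.comp_continuous ?_ (by fun_prop)
    simpa using hmax
  have hzero := hloc.hasDerivAt_eq_zero (hdG.congr_of_eventuallyEq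
    (Filter.Eventually.of_forall fun s => ?_))
  · simpa [ballCutoff, spaceSecondDiff] using hzero
  · have i1 : t + s * τ - s₀ = t - s₀ + s * τ := by ring
    have i2 : q + s • v - q₀ = q - q₀ + s • v := by abel
    have i3 : q + s • v + (h + s • k) = q + h + s • (v + k) := by module
    have i4 : q + s • v - (h + s • k) = q - h + s • (v - k) := by module
    simp [ballCutoff, spaceSecondDiff, i1, i2, i3, i4]

/-- The localised second difference cannot be critical for a large penalisation. -/
theorem penalisation_le_of_isLocalMax {H : ℝ → E → E → ℝ} {u : ℝ × E → ℝ} {p : ℝ × E → E}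
    {m M K L R s₀ σ δ B₀ t : ℝ} {q₀ q h : E} (hm : 0 < m) (hL : 0 ≤ L) (hM : 0 ≤ M)
    (hR : 0 ≤ R) (hR1 : R ≤ 1)
    (hH : ∀ q p h k : E, m * ‖k‖ ^ 2 - 2 * M * ‖h‖ * ‖k‖ - M * ‖h‖ ^ 2 ≤
      H t (q + h) (p + k) + H t (q - h) (p - k) - 2 * H t q p)
    (hu : ∀ y, HasFDerivAt u (spacetimeForm (H t y (p (t, y))) (p (t, y))) (t, y))
    (h₀ : ‖p (t, q)‖ ≤ K) (h₁ : ‖p (t, q + h)‖ ≤ K) (h₂ : ‖p (t, q - h)‖ ≤ K)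
    (hlip : ∀ r r' : E, ‖r‖ ≤ K → ‖r'‖ ≤ K → |H t q r - H t q r'| ≤ L * ‖r - r'‖)
    (hσ : |σ| = 1) (ht : |t - s₀| ≤ R) (hq : ‖q - q₀‖ ≤ R) (hh : h ≠ 0)
    (hρ : 0 < ballCutoff R s₀ q₀ (t, q, h))
    (hmax : IsLocalMax (fun z : ℝ × E × E =>
      ballCutoff R s₀ q₀ z * (σ * spaceSecondDiff u z - δ) - B₀ * ‖z.2.2‖ ^ 2) (t, q, h))
    (heq : ballCutoff R s₀ q₀ (t, q, h) * (σ * spaceSecondDiff u (t, q, h) - δ) =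
      B₀ * ‖h‖ ^ 2) :
    B₀ ≤ 1 + 6 * M / m + 4 * (1 + L) / m := by
  set A₀ : ℝ := 1 + 6 * M / m + 4 * (1 + L) / m with hA₀
  have hA₀pos : 0 < A₀ := by positivity
  by_contra! hA₀B
  have hstat := secondDiff_stationary (a := fun z => H z.1 z.2 (p z)) hu hmax
  dsimp only at hstat
  have hσσ : σ * σ = 1 := by rw [← abs_mul_abs_self, hσ, one_mul]
  set p₀ := p (t, q)
  set p₁ := p (t, q + h)
  set p₂ := p (t, q - h)
  set r := ballCutoff R s₀ q₀ (t, q, h) with hr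
  set B := B₀ / r with hB
  have hB0 : B₀ = r * B := by rw [hB]; field_simp
  have hBpos : 0 < B := div_pos (hA₀pos.trans hA₀B) hρ
  set D := B / r with hD
  have hDpos : 0 < D := div_pos hBpos hρ
  have hB1 : B = r * D := by rw [hD]; field_simp
  have hG : σ * spaceSecondDiff u (t, q, h) - δ = r * D * ‖h‖ ^ 2 := by
    refine mul_left_cancel₀ hρ.ne' ?_
    rw [heq, hB0, hB1]; ring
  rw [hG] at hstat
  have hσ2 (a : ℝ) : σ * (σ * a) = a := by rw [← mul_assoc, hσσ, one_mul]
  have hdiff : p₁ - p₂ = (2 * σ * B) • h := by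
    refine ext_inner_right ℝ fun k => ?_
    have := hstat 0 0 k
    simp only [mul_zero, inner_zero_right, zero_add, sub_zero, zero_sub, zero_mul,
      inner_neg_right, hB0] at this
    have h2 : σ * (⟪p₁, k⟫ + -⟪p₂, k⟫) = 2 * B * ⟪h, k⟫ :=
      mul_left_cancel₀ hρ.ne' (by linarith)
    rw [inner_sub_left, real_inner_smul_left, sub_eq_add_neg, ← hσ2 (_ + _), h2]
    ring
  have hmid : p₁ + p₂ - (2 : ℝ) • p₀ = (2 * σ * D * ‖h‖ ^ 2) • (q - q₀) := by
    refine ext_inner_right ℝ fun v => ?_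
    have := hstat 0 v 0
    simp only [mul_zero, inner_zero_right, zero_add, sub_zero, zero_sub, add_zero] at this
    have h2 : σ * (⟪p₁, v⟫ + ⟪p₂, v⟫ - 2 * ⟪p₀, v⟫) = 2 * D * ‖h‖ ^ 2 * ⟪q - q₀, v⟫ :=
      mul_left_cancel₀ hρ.ne' (by linarith)
    rw [inner_sub_left, inner_add_left, real_inner_smul_left, real_inner_smul_left,
      ← hσ2 (_ - _), h2]
    ring
  have htime : H t (q + h) p₁ + H t (q - h) p₂ - 2 * H t q p₀ ≤ 2 * D * ‖h‖ ^ 2 := by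
    have := hstat 1 0 0
    simp only [mul_zero, inner_zero_right, sub_zero, add_zero, mul_one] at this
    have h2 : σ * (H t (q + h) p₁ + H t (q - h) p₂ - 2 * H t q p₀) =
        -(t - s₀) * (2 * D * ‖h‖ ^ 2) :=
      mul_left_cancel₀ hρ.ne' (by linarith)
    refine (le_abs_self _).trans ?_
    rw [← one_mul |_|, ← hσ, ← abs_mul, h2, abs_mul, abs_neg,
      abs_of_nonneg (by positivity : 0 ≤ 2 * D * ‖h‖ ^ 2)]
    exact mul_le_of_le_one_left (by positivity) (ht.trans hR1)
  have hcrit := le_of_secondDifference_critical hL hDpos.le hH hlip hσ hBpos.le hh h₀ h₁ h₂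
    (hq.trans hR1) hdiff hmid htime
  have hA₀D : A₀ * D ≤ B ^ 2 := by
    calc A₀ * D ≤ (r * B) * D := by gcongr; rw [← hB0]; exact hA₀B.le
      _ = B * (r * D) := by ring
      _ = B ^ 2 := by rw [← hB1, sq]
  have hAB : A₀ < B := by
    refine hA₀B.trans_le ?_
    rw [hB0]
    refine mul_le_of_le_one_left hBpos.le ?_
    have : R ^ 2 ≤ 1 := pow_le_one₀ hR hR1
    simp only [hr, ballCutoff]
    nlinarith [sq_nonneg (t - s₀), sq_nonneg ‖q - q₀‖]
  have hmA : m * A₀ = m + 6 * M + 4 * (1 + L) := by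
    rw [hA₀]; field_simp
  have hLD : 4 * (1 + L) * D ≤ m * B ^ 2 := by
    calc 4 * (1 + L) * D ≤ (m * A₀) * D :=
        mul_le_mul_of_nonneg_right (by linarith) hDpos.le
      _ = m * (A₀ * D) := by ring
      _ ≤ m * B ^ 2 := by gcongr
  have hB1' : 1 ≤ B := by
    have : 0 ≤ 6 * M / m + 4 * (1 + L) / m := by positivity
    linarith
  have hmB : 6 * M < m * B := by nlinarith
  nlinarith [mul_lt_mul_of_pos_right hmB hBpos, mul_le_mul_of_nonneg_left hB1' hM]
/-- A two-sided local bound on the second space differences of a `C¹` solution of the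
Hamilton–Jacobi equation. -/
theorem exists_secondDifference_le [FiniteDimensional ℝ E] {H : ℝ → E → E → ℝ}
    {m M K L R s₀ : ℝ} {q₀ : E} (hm : 0 < m) (hL : 0 ≤ L) (hK : 0 ≤ K) (hM : 0 ≤ M)
    (hR1 : R ≤ 1) (hR : 0 < R)
    (hH : ∀ t (q p h k : E), m * ‖k‖ ^ 2 - 2 * M * ‖h‖ * ‖k‖ - M * ‖h‖ ^ 2 ≤
      H t (q + h) (p + k) + H t (q - h) (p - k) - 2 * H t q p)
    {u : ℝ × E → ℝ} {p : ℝ × E → E}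
    (hu : ∀ z : ℝ × E, |z.1 - s₀| ≤ R →
      HasFDerivAt u (spacetimeForm (H z.1 z.2 (p z)) (p z)) z)
    (hp : ∀ z : ℝ × E, |z.1 - s₀| ≤ R → ‖z.2 - q₀‖ ≤ 2 → ‖p z‖ ≤ K)
    (hlip : ∀ t q, |t - s₀| ≤ R → ‖q - q₀‖ ≤ 2 → ∀ r r' : E, ‖r‖ ≤ K → ‖r'‖ ≤ K →
      |H t q r - H t q r'| ≤ L * ‖r - r'‖) :
    ∃ A, 0 < A ∧ ∀ t q h, 0 ≤ R ^ 2 - (t - s₀) ^ 2 - ‖q - q₀‖ ^ 2 → ‖h‖ ≤ 1 →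
      (R ^ 2 - (t - s₀) ^ 2 - ‖q - q₀‖ ^ 2) *
        |u (t, q + h) + u (t, q - h) - 2 * u (t, q)| ≤ A * ‖h‖ ^ 2 := by
  set A₀ : ℝ := 1 + 2 * K + 6 * M / m + 4 * (1 + L) / m with hA₀
  have hA₀pos : 0 < A₀ := by positivity
  refine ⟨A₀, hA₀pos, ?_⟩
  set ρ : ℝ × E × E → ℝ := ballCutoff R s₀ q₀ with hρ
  set Δ : ℝ × E × E → ℝ := spaceSecondDiff u with hΔ
  have hρ1 (x) : ρ x ≤ 1 := by
    have : R ^ 2 ≤ 1 := pow_le_one₀ hR.le hR1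
    simp only [hρ, ballCutoff]; nlinarith [sq_nonneg (x.1 - s₀), sq_nonneg ‖x.2.1 - q₀‖]
  have hρt {x} (hx : 0 ≤ ρ x) : |x.1 - s₀| ≤ R := by
    refine abs_le_of_sq_le_sq ?_ hR.le
    simp only [hρ, ballCutoff] at hx; nlinarith [sq_nonneg ‖x.2.1 - q₀‖]
  have hρq {x} (hx : 0 ≤ ρ x) : ‖x.2.1 - q₀‖ ≤ R := by
    refine le_of_sq_le_sq ?_ hR.le
    simp only [hρ, ballCutoff] at hx; nlinarith [sq_nonneg (x.1 - s₀)]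
  have hρc : Continuous ρ := by unfold ρ ballCutoff; fun_prop
  have hadd {x : ℝ × E × E} (hx : 0 ≤ ρ x) (hx1 : ‖x.2.2‖ ≤ 1) :
      ‖x.2.1 + x.2.2 - q₀‖ ≤ 2 := by
    rw [add_sub_right_comm]
    linarith [norm_add_le (x.2.1 - q₀) x.2.2, hρq hx]
  have hsub {x : ℝ × E × E} (hx : 0 ≤ ρ x) (hx1 : ‖x.2.2‖ ≤ 1) :
      ‖x.2.1 - x.2.2 - q₀‖ ≤ 2 := by
    rw [sub_right_comm]
    linarith [norm_sub_le (x.2.1 - q₀) x.2.2, hρq hx]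
  have hΔK {x : ℝ × E × E} (hx : 0 ≤ ρ x) (hx1 : ‖x.2.2‖ ≤ 1) : |Δ x| ≤ 2 * K * ‖x.2.2‖ := by
    have hd (y : E) : HasFDerivAt (fun y => u (x.1, y)) (innerSL ℝ (p (x.1, y))) y :=
      (hu (x.1, y) (hρt hx)).space_section
    have mvt {y y' : E} (hy : ‖y - q₀‖ ≤ 2) (hy' : ‖y' - q₀‖ ≤ 2) :
        |u (x.1, y') - u (x.1, y)| ≤ K * ‖y' - y‖ :=
      (convex_closedBall q₀ 2).norm_image_sub_le_of_norm_hasFDerivWithin_le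
        (fun y _ => (hd y).hasFDerivWithinAt)
        (fun y hy => by
          rw [innerSL_apply_norm]
          exact hp (x.1, y) (hρt hx) (mem_closedBall_iff_norm.1 hy))
        (mem_closedBall_iff_norm.2 hy) (mem_closedBall_iff_norm.2 hy')
    have h0 : ‖x.2.1 - q₀‖ ≤ 2 := by linarith [hρq hx]
    have h1 := mvt h0 (hadd hx hx1)
    have h2 := mvt h0 (hsub hx hx1)
    rw [add_sub_cancel_left] at h1
    rw [sub_sub_cancel_left, norm_neg] at h2
    have := abs_add_le (u (x.1, x.2.1 + x.2.2) - u (x.1, x.2.1))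
      (u (x.1, x.2.1 - x.2.2) - u (x.1, x.2.1))
    calc |Δ x| = _ := by simp only [hΔ, spaceSecondDiff]; congr 1; ring
      _ ≤ _ := this
      _ ≤ _ := by linarith
  have main (σ : ℝ) (hσ : |σ| = 1) (x : ℝ × E × E) (hx : 0 ≤ ρ x) (hx1 : ‖x.2.2‖ ≤ 1) :
      ρ x * (σ * Δ x) ≤ A₀ * ‖x.2.2‖ ^ 2 := by
    by_contra! hcon
    have hσΔ {y} (hy : 0 ≤ ρ y) (hy1 : ‖y.2.2‖ ≤ 1) : σ * Δ y ≤ 2 * K * ‖y.2.2‖ := by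
      refine (le_abs_self _).trans ?_
      rw [abs_mul, hσ, one_mul]
      exact hΔK hy hy1
    obtain ⟨δ, hδ, hδx⟩ : ∃ δ > 0, A₀ * ‖x.2.2‖ ^ 2 < ρ x * (σ * Δ x - δ) := by
      refine ⟨(ρ x * (σ * Δ x) - A₀ * ‖x.2.2‖ ^ 2) / 2, by linarith, ?_⟩
      nlinarith [hρ1 x]
    have hΔpos {y} (hy : 0 ≤ ρ y) (h : A₀ * ‖y.2.2‖ ^ 2 < ρ y * (σ * Δ y - δ)) :
        0 < ρ y ∧ δ < σ * Δ y := by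
      have h0 : 0 < ρ y * (σ * Δ y - δ) := lt_of_le_of_lt (by positivity) h
      have h1 : 0 < ρ y := hy.lt_of_ne (by rintro e; rw [← e] at h0; simp at h0)
      exact ⟨h1, by linarith [pos_of_mul_pos_right h0 h1.le]⟩
    set h₀ : ℝ := δ / (2 * K + 1) with hh₀
    have hh₀pos : 0 < h₀ := by positivity
    have hsmall {y} (hy : 0 ≤ ρ y) (hy1 : ‖y.2.2‖ ≤ 1) (h : δ < σ * Δ y) : h₀ < ‖y.2.2‖ := by
      rw [hh₀, div_lt_iff₀ (by positivity)]
      nlinarith [hσΔ hy hy1, norm_nonneg y.2.2]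
    set S : Set (ℝ × E × E) := {y | 0 ≤ ρ y ∧ h₀ ≤ ‖y.2.2‖ ∧ ‖y.2.2‖ ≤ 1}
    have hnc : Continuous fun y : ℝ × E × E => ‖y.2.2‖ := by fun_prop
    have hScomp : IsCompact S := by
      refine (isCompact_closedBall ((s₀, q₀, 0) : ℝ × E × E) 1).of_isClosed_subset ?_ ?_
      · change IsClosed ({y | 0 ≤ ρ y} ∩ ({y | h₀ ≤ ‖y.2.2‖} ∩ {y | ‖y.2.2‖ ≤ 1}))
        exact (isClosed_le continuous_const hρc).inter
          ((isClosed_le continuous_const hnc).inter (isClosed_le hnc continuous_const))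
      · rintro y ⟨hy, -, hy1⟩
        rw [mem_closedBall_iff_norm, Prod.norm_def, Prod.norm_def]
        simp only [Prod.fst_sub, Prod.snd_sub, sub_zero]
        exact max_le ((hρt hy).trans hR1) (max_le ((hρq hy).trans hR1) hy1)
    set Q : ℝ × E × E → ℝ := fun y => ρ y * (σ * Δ y - δ) / ‖y.2.2‖ ^ 2 with hQ
    have hQc : ContinuousOn Q S := by
      have huc {f : ℝ × E × E → E} (hf : Continuous f) :
          ContinuousOn (fun y : ℝ × E × E => u (y.1, f y)) S := fun y hy =>
        ((hu (y.1, f y) (hρt hy.1)).continuousAt.comp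
          (f := fun y : ℝ × E × E => (y.1, f y)) (by fun_prop)).continuousWithinAt
      have hΔc : ContinuousOn Δ S :=
        ((huc (by fun_prop : Continuous fun y : ℝ × E × E => y.2.1 + y.2.2)).add
          (huc (by fun_prop : Continuous fun y : ℝ × E × E => y.2.1 - y.2.2))).sub
          (continuousOn_const.mul (huc (by fun_prop : Continuous fun y : ℝ × E × E => y.2.1)))
      refine ContinuousOn.div (hρc.continuousOn.mul ((continuousOn_const.mul hΔc).sub
        continuousOn_const)) (by fun_prop) ?_
      rintro y ⟨-, hy, -⟩
      have : 0 < ‖y.2.2‖ := hh₀pos.trans_le hy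
      positivity
    have hxS : x ∈ S := ⟨hx, (hsmall hx hx1 (hΔpos hx hδx).2).le, hx1⟩
    obtain ⟨y, hyS, hymax⟩ := hScomp.exists_isMaxOn ⟨x, hxS⟩ hQc
    set B₀ : ℝ := Q y with hB₀
    have hnpos {z} (hz : z ∈ S) : 0 < ‖z.2.2‖ := hh₀pos.trans_le hz.2.1
    have hA₀B : A₀ < B₀ := by
      refine lt_of_lt_of_le ?_ (hymax hxS)
      rw [hQ, lt_div_iff₀ (pow_pos (hnpos hxS) 2)]
      exact hδx
    have hyeq : ρ y * (σ * Δ y - δ) = B₀ * ‖y.2.2‖ ^ 2 := by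
      rw [hB₀, hQ, div_mul_cancel₀]
      exact (pow_pos (hnpos hyS) 2).ne'
    obtain ⟨hρy, hΔy⟩ := hΔpos hyS.1 (by
      rw [hyeq]; exact mul_lt_mul_of_pos_right hA₀B (pow_pos (hnpos hyS) 2))
    have hy0 := hsmall hyS.1 hyS.2.2 hΔy
    have hy1 : ‖y.2.2‖ < 1 := by
      have h1 : ρ y * (σ * Δ y - δ) ≤ 1 * (2 * K * ‖y.2.2‖) :=
        mul_le_mul (hρ1 y) (by linarith [hσΔ hyS.1 hyS.2.2]) (by linarith) zero_le_one
      rw [hyeq] at h1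
      have h2 : B₀ * ‖y.2.2‖ ≤ 2 * K := by
        refine le_of_mul_le_mul_right ?_ (hnpos hyS)
        linarith
      have h3 : 2 * K < A₀ := by
        have : 0 ≤ 6 * M / m + 4 * (1 + L) / m := by positivity
        linarith
      by_contra! h4
      nlinarith
    have hlocal : IsLocalMax
        (fun z : ℝ × E × E => ρ z * (σ * Δ z - δ) - B₀ * ‖z.2.2‖ ^ 2) y := by
      have hev : ∀ᶠ z in nhds y, z ∈ S := by
        have a1 := hρc.continuousAt.eventually (lt_mem_nhds hρy)
        have a2 : ∀ᶠ z : ℝ × E × E in nhds y, h₀ < ‖z.2.2‖ :=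
          hnc.continuousAt.eventually (lt_mem_nhds hy0)
        have a3 : ∀ᶠ z : ℝ × E × E in nhds y, ‖z.2.2‖ < 1 :=
          hnc.continuousAt.eventually (gt_mem_nhds hy1)
        filter_upwards [a1, a2, a3] with z h1 h2 h3 using ⟨h1.le, h2.le, h3.le⟩
      filter_upwards [hev] with z hz
      have : ρ z * (σ * Δ z - δ) / ‖z.2.2‖ ^ 2 ≤ B₀ := hymax hz
      rw [div_le_iff₀ (pow_pos (hnpos hz) 2)] at this
      simp only [hyeq]
      linarith
    have hq2 : ‖y.2.1 - q₀‖ ≤ 2 := by linarith [hρq hyS.1]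
    have hty := hρt hyS.1
    have hB₀A := penalisation_le_of_isLocalMax (t := y.1) (q := y.2.1) (h := y.2.2) hm hL hM
      hR.le hR1 (hH y.1) (fun z => hu (y.1, z) hty) (hp _ hty hq2) (hp _ hty (hadd hyS.1 hyS.2.2))
      (hp _ hty (hsub hyS.1 hyS.2.2)) (hlip _ _ hty hq2) hσ hty (hρq hyS.1)
      (norm_pos_iff.1 (hnpos hyS)) hρy hlocal hyeq
    linarith
  intro t q h hx hh
  have hpos := main 1 (by simp) (t, q, h) hx hh
  have hneg := main (-1) (by simp) (t, q, h) hx hh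
  simp only [hρ, hΔ, ballCutoff, spaceSecondDiff] at hpos hneg
  rcases abs_cases (u (t, q + h) + u (t, q - h) - 2 * u (t, q)) with ⟨e, -⟩ | ⟨e, -⟩ <;> rw [e]
  · linarith
  · linarith

theorem norm_le_norm_spacetimeForm (a : ℝ) (p : E) : ‖p‖ ≤ ‖spacetimeForm a p‖ := by
  rcases eq_or_ne p 0 with rfl | hp
  · exact norm_zero.trans_le (norm_nonneg (spacetimeForm a (0 : E)))
  have h := (spacetimeForm a p).le_opNorm ((0 : ℝ), p)
  have hn : ‖((0 : ℝ), p)‖ = ‖p‖ := by simp [Prod.norm_def]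
  rw [hn, spacetimeForm_apply] at h
  simp only [mul_zero, zero_add, real_inner_self_eq_norm_mul_norm, norm_mul, norm_norm] at h
  exact le_of_mul_le_mul_right h (norm_pos_iff.2 hp)

theorem hasFDerivAt_spacetimeForm_of_hamiltonJacobi [CompleteSpace E] {u : ℝ × E → ℝ}
    {a t : ℝ} {q : E} (hu : DifferentiableAt ℝ u (t, q))
    (hHJ : deriv (fun τ => u (τ, q)) t + a = 0) :
    HasFDerivAt u (spacetimeForm a (gradient (fun y => u (t, y)) q)) (t, q) := by
  refine hu.hasFDerivAt.congr_fderiv ?_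
  have ht : HasDerivAt (fun τ => u (τ, q)) (fderiv ℝ u (t, q) ((1 : ℝ), (0 : E))) t :=
    hu.hasFDerivAt.comp_hasDerivAt t ((hasDerivAt_id t).prodMk (hasDerivAt_const t q))
  have hq : HasFDerivAt (fun y => u (t, y))
      ((fderiv ℝ u (t, q)).comp (ContinuousLinearMap.inr ℝ ℝ E)) q :=
    hu.hasFDerivAt.comp q (hasFDerivAt_prodMk_right t q)
  rw [ht.deriv] at hHJ
  ext v
  · simp; linarith
  · simp [gradient, hq.fderiv]

/-- If the space gradient of a solution is Lipschitz in space, then it is Lipschitz in time. -/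
theorem norm_sub_le_of_space_lipschitz {u : ℝ × E → ℝ} {a : ℝ × E → ℝ} {p : ℝ × E → E}
    {I : Set ℝ} {V : Set E} {C : ℝ} (hC : 0 ≤ C) (hI : Convex ℝ I) (hV : IsOpen V)
    (hu : ∀ t ∈ I, ∀ y ∈ V, HasFDerivAt u (spacetimeForm (a (t, y)) (p (t, y))) (t, y))
    (ha : ∀ t ∈ I, ∀ x ∈ V, ∀ y ∈ V, |a (t, y) - a (t, x)| ≤ C * ‖y - x‖)
    {s t : ℝ} (hs : s ∈ I) (ht : t ∈ I) {q : E} (hq : q ∈ V) :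
    ‖p (t, q) - p (s, q)‖ ≤ C * |t - s| := by
  have hd : HasFDerivAt (fun y => u (t, y) - u (s, y)) (innerSL ℝ (p (t, q) - p (s, q))) q := by
    rw [map_sub]
    exact (hu t ht q hq).space_section.sub (hu s hs q hq).space_section
  rw [← innerSL_apply_norm (𝕜 := ℝ)]
  have hCts : 0 ≤ C * |t - s| := by positivity
  refine hd.le_of_lipschitzOn (hV.mem_nhds hq) (C := .mk (C * |t - s|) hCts) ?_
  refine LipschitzOnWith.of_dist_le_mul fun y hy x hx => ?_
  have := hI.norm_image_sub_le_of_norm_hasDerivWithin_le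
    (f := fun τ => u (τ, y) - u (τ, x)) (f' := fun τ => -a (τ, y) - -a (τ, x))
    (C := C * ‖y - x‖)
    (fun τ hτ => ((hu τ hτ y hy).time_section.sub (hu τ hτ x hx).time_section).hasDerivWithinAt)
    (fun τ hτ => by
      rw [neg_sub_neg, norm_sub_rev]
      exact ha τ hτ x hx y hy) hs ht
  rw [dist_eq_norm, dist_eq_norm, NNReal.coe_mk]
  rw [Real.norm_eq_abs (t - s)] at this
  calc ‖u (t, y) - u (s, y) - (u (t, x) - u (s, x))‖
      = ‖u (t, y) - u (t, x) - (u (s, y) - u (s, x))‖ := by congr 1; ring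
    _ ≤ _ := this
    _ = _ := by ring

/-- Local Lipschitz continuity of the differential of a `C¹` solution near a point. -/
theorem exists_lipschitzOnWith_fderiv [FiniteDimensional ℝ E] {H : ℝ → E → E → ℝ}
    (hHC : ContDiff ℝ 1 (fun x : ℝ × E × E => H x.1 x.2.1 x.2.2))
    {m M t₀ t₁ s₀ : ℝ} {q₀ : E} (hm : 0 < m) (hM : 0 ≤ M)
    (hH : ∀ t (q p h k : E), m * ‖k‖ ^ 2 - 2 * M * ‖h‖ * ‖k‖ - M * ‖h‖ ^ 2 ≤
      H t (q + h) (p + k) + H t (q - h) (p - k) - 2 * H t q p)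
    {u : ℝ × E → ℝ} {p : ℝ × E → E}
    (huc : ContinuousOn (fderiv ℝ u) (Ioo t₀ t₁ ×ˢ univ))
    (hu : ∀ z : ℝ × E, z.1 ∈ Ioo t₀ t₁ →
      HasFDerivAt u (spacetimeForm (H z.1 z.2 (p z)) (p z)) z)
    (hs₀ : s₀ ∈ Ioo t₀ t₁) :
    ∃ ε > 0, ball (s₀, q₀) ε ⊆ Ioo t₀ t₁ ×ˢ univ ∧
      ∃ C : ℝ≥0, LipschitzOnWith C (fderiv ℝ u) (ball (s₀, q₀) ε) := by
  obtain ⟨R, hR, hR1, hRI⟩ : ∃ R : ℝ, 0 < R ∧ R ≤ 1 ∧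
      ∀ t : ℝ, |t - s₀| ≤ R → t ∈ Ioo t₀ t₁ := by
    obtain ⟨r, hr, hrI⟩ := nhds_basis_closedBall.mem_iff.1 (Ioo_mem_nhds hs₀.1 hs₀.2)
    exact ⟨min r 1, by positivity, min_le_right _ _,
      fun t ht => hrI (mem_closedBall_iff_norm.2 (ht.trans (min_le_left _ _)))⟩
  have hmemK {t : ℝ} {q : E} (ht : |t - s₀| ≤ R) (hq : ‖q - q₀‖ ≤ 2) :
      (t, q) ∈ closedBall s₀ R ×ˢ closedBall q₀ 2 :=
    ⟨mem_closedBall_iff_norm.2 ht, mem_closedBall_iff_norm.2 hq⟩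
  have huK : ContinuousOn (fderiv ℝ u) (closedBall s₀ R ×ˢ closedBall q₀ 2) :=
    huc.mono fun z hz => ⟨hRI _ (mem_closedBall_iff_norm.1 hz.1), mem_univ _⟩
  obtain ⟨K, hK⟩ := ((isCompact_closedBall s₀ R).prod
    (isCompact_closedBall q₀ 2)).bddAbove_image
      (ContinuousOn.norm (E := ℝ × E →L[ℝ] ℝ) huK)
  have hp (z : ℝ × E) (ht : |z.1 - s₀| ≤ R) (hq : ‖z.2 - q₀‖ ≤ 2) : ‖p z‖ ≤ K := by
    refine (norm_le_norm_spacetimeForm (H z.1 z.2 (p z)) (p z)).trans ?_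
    rw [← (hu z (hRI _ ht)).fderiv]
    exact hK (mem_image_of_mem _ (hmemK ht hq))
  have hK0 : 0 ≤ K := (norm_nonneg _).trans (hp (s₀, q₀) (by simp [hR.le]) (by simp))
  obtain ⟨L, hL⟩ := hHC.contDiffOn.exists_lipschitzOnWith (by norm_num)
    ((convex_closedBall s₀ R).prod ((convex_closedBall q₀ 2).prod (convex_closedBall (0 : E) K)))
    ((isCompact_closedBall s₀ R).prod
      ((isCompact_closedBall q₀ 2).prod (isCompact_closedBall (0 : E) K)))
  have hHlip {z z' : ℝ × E} {r r' : E} (ht : |z.1 - s₀| ≤ R) (hq : ‖z.2 - q₀‖ ≤ 2)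
      (ht' : |z'.1 - s₀| ≤ R) (hq' : ‖z'.2 - q₀‖ ≤ 2) (hr : ‖r‖ ≤ K) (hr' : ‖r'‖ ≤ K) :
      |H z.1 z.2 r - H z'.1 z'.2 r'| ≤ L * (‖z - z'‖ + ‖r - r'‖) := by
    have := hL.dist_le_mul (z.1, z.2, r)
      ⟨mem_closedBall_iff_norm.2 ht, mem_closedBall_iff_norm.2 hq, mem_closedBall_zero_iff.2 hr⟩
      (z'.1, z'.2, r') ⟨mem_closedBall_iff_norm.2 ht', mem_closedBall_iff_norm.2 hq',
        mem_closedBall_zero_iff.2 hr'⟩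
    rw [dist_eq_norm, dist_eq_norm] at this
    refine this.trans ?_
    gcongr
    rw [Prod.norm_def, Prod.norm_def]
    have h1 := norm_fst_le (z - z')
    have h2 := norm_snd_le (z - z')
    exact max_le (h1.trans (by simp)) (max_le (h2.trans (by simp)) (by simp))
  obtain ⟨A, hA, hsd⟩ := exists_secondDifference_le (q₀ := q₀) hm L.coe_nonneg hK0 hM hR1 hR hH
    (fun z hz => hu z (hRI _ hz)) hp (fun t q ht hq r r' hr hr' => by
      simpa using hHlip (z := (t, q)) (z' := (t, q)) ht hq ht hq hr hr')
  set C : ℝ := 12 * (2 * A / R ^ 2)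
  have hCpos : 0 < C := by positivity
  have hspace {t : ℝ} (ht : |t - s₀| ≤ R / 2) {x y : E} (hx : x ∈ ball q₀ (R / 2 / 4))
      (hy : y ∈ ball q₀ (R / 2 / 4)) : ‖p (t, y) - p (t, x)‖ ≤ C * ‖y - x‖ := by
    have htR : |t - s₀| ≤ R := by linarith
    rw [← innerSL_apply_norm (𝕜 := ℝ), map_sub]
    refine norm_fderiv_sub_le_of_abs_secondDifference_le (f := fun y => u (t, y))
      (f' := fun y => innerSL ℝ (p (t, y))) (by positivity) (by linarith : R / 2 ≤ 1)
      (fun y => (hu (t, y) (hRI t htR)).space_section) (fun y hy k hk => ?_) hx hy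
    rw [mem_ball_iff_norm] at hy
    have e1 : (t - s₀) ^ 2 ≤ (R / 2) ^ 2 := sq_le_sq' (abs_le.1 ht).1 (abs_le.1 ht).2
    have e2 : ‖y - q₀‖ ^ 2 ≤ (R / 2) ^ 2 := by gcongr
    have hcut : R ^ 2 / 2 ≤ R ^ 2 - (t - s₀) ^ 2 - ‖y - q₀‖ ^ 2 := by linarith
    have hR2 : 0 < R ^ 2 := by positivity
    have := (mul_le_mul_of_nonneg_right hcut (abs_nonneg _)).trans
      (hsd t y k (by linarith) hk)
    rw [div_mul_eq_mul_div, le_div_iff₀ hR2]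
    linarith
  have hball {q : E} (hq : q ∈ ball q₀ (R / 2 / 4)) : ‖q - q₀‖ ≤ 2 := by
    rw [mem_ball_iff_norm] at hq
    linarith
  have hclosed {t : ℝ} (ht : t ∈ closedBall s₀ (R / 2)) : |t - s₀| ≤ R := by
    rw [mem_closedBall_iff_norm, Real.norm_eq_abs] at ht
    linarith
  have htime {s t : ℝ} (hs : s ∈ closedBall s₀ (R / 2)) (ht : t ∈ closedBall s₀ (R / 2))
      {q : E} (hq : q ∈ ball q₀ (R / 2 / 4)) :
      ‖p (t, q) - p (s, q)‖ ≤ (L * (1 + C)) * |t - s| := by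
    refine norm_sub_le_of_space_lipschitz (u := u) (a := fun z => H z.1 z.2 (p z))
      (by positivity) (convex_closedBall s₀ (R / 2)) isOpen_ball
      (fun t ht y _ => hu (t, y) (hRI t (hclosed ht))) (fun t ht x hx y hy => ?_) hs ht hq
    have htR := hclosed ht
    refine (hHlip (z := (t, y)) (z' := (t, x)) htR (hball hy) htR (hball hx)
      (hp _ htR (hball hy)) (hp _ htR (hball hx))).trans ?_
    have hn : ‖(t, y) - (t, x)‖ = ‖y - x‖ := by simp [Prod.norm_def]
    rw [hn, mul_assoc]
    gcongr
    linarith [hspace (mem_closedBall_iff_norm.1 ht) hx hy]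
  have hsub : ball (s₀, q₀) (R / 2 / 4) ⊆ closedBall s₀ (R / 2) ×ˢ ball q₀ (R / 2 / 4) := by
    rw [← ball_prod_same]
    exact prod_mono (ball_subset_closedBall.trans (closedBall_subset_closedBall (by linarith)))
      Subset.rfl
  refine ⟨R / 2 / 4, by positivity, fun z hz =>
    ⟨hRI _ (hclosed (hsub hz).1), mem_univ _⟩,
    .mk (L + (1 + L) * (C + L * (1 + C))) (by positivity), ?_⟩
  refine LipschitzOnWith.of_dist_le_mul fun z hz z' hz' => ?_
  obtain ⟨hz1, hz2⟩ := hsub hz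
  obtain ⟨hz1', hz2'⟩ := hsub hz'
  have hpp : ‖p z - p z'‖ ≤ (C + L * (1 + C)) * ‖z - z'‖ := by
    have h1 := hspace (mem_closedBall_iff_norm.1 hz1) hz2' hz2
    have h2 := htime hz1' hz1 hz2'
    have h3 : C * ‖z.2 - z'.2‖ ≤ C * ‖z - z'‖ := by
      gcongr
      exact norm_snd_le (z - z')
    have h4 : (L * (1 + C)) * |z.1 - z'.1| ≤ (L * (1 + C)) * ‖z - z'‖ := by
      gcongr
      exact norm_fst_le (z - z')
    have h5 := norm_sub_le_norm_sub_add_norm_sub (p (z.1, z.2)) (p (z.1, z'.2)) (p (z'.1, z'.2))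
    simp only [Prod.mk.eta] at *
    linarith
  have hHH := hHlip (hclosed hz1) (hball hz2) (hclosed hz1') (hball hz2')
    (hp z (hclosed hz1) (hball hz2)) (hp z' (hclosed hz1') (hball hz2'))
  have hLpp := mul_le_mul_of_nonneg_left hpp L.coe_nonneg
  rw [(hu z (hRI _ (hclosed hz1))).fderiv, (hu z' (hRI _ (hclosed hz1'))).fderiv, dist_eq_norm,
    dist_eq_norm, NNReal.coe_mk]
  refine (norm_spacetimeForm_sub_le _ _ _ _).trans ?_
  linarith

end SecondDifferenceEstimate

/-- Under hypotheses 1, 2, 3, every `C¹` solution of the Hamilton–Jacobi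
equation on `(t₀,t₁) × ℝᵈ` is locally `C^{1,1}`: its differential is locally Lipschitz. -/
theorem C1_solutions_are_locally_C11 {d : ℕ}
    (H : ℝ → EuclideanSpace ℝ (Fin d) → EuclideanSpace ℝ (Fin d) → ℝ)
    (hH : ContDiff ℝ 2 (fun x : ℝ × EuclideanSpace ℝ (Fin d) × EuclideanSpace ℝ (Fin d) =>
      H x.1 x.2.1 x.2.2))
    (m M : ℝ) (hm : 0 < m) (hmM : m ≤ M)
    -- Hypothesis 1: `‖d²H‖ ≤ M`
    (hd2H : ∀ x : ℝ × EuclideanSpace ℝ (Fin d) × EuclideanSpace ℝ (Fin d),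
      ‖iteratedFDeriv ℝ 2
        (fun y : ℝ × EuclideanSpace ℝ (Fin d) × EuclideanSpace ℝ (Fin d) =>
          H y.1 y.2.1 y.2.2) x‖ ≤ M)
    -- Hypothesis 2: `∂²ₚₚH ≥ m·Id` in the sense of quadratic forms
    (hconv : ∀ (t : ℝ) (q p v : EuclideanSpace ℝ (Fin d)),
      m * ‖v‖ ^ 2 ≤ iteratedFDeriv ℝ 2 (fun p' => H t q p') p ![v, v])
    -- Hypothesis 3
    (hlower : ∀ (t : ℝ) (q p : EuclideanSpace ℝ (Fin d)),
      m / 2 * ‖p‖ ^ 2 - M ≤ H t q p)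
    (hupper : ∀ (t : ℝ) (q p : EuclideanSpace ℝ (Fin d)),
      H t q p ≤ M / 2 * ‖p‖ ^ 2 + M)
    (t₀ t₁ : ℝ)
    (u : ℝ × EuclideanSpace ℝ (Fin d) → ℝ)
    -- `u` is `C¹` on `(t₀, t₁) × ℝᵈ`
    (hu_C1 : ContDiffOn ℝ 1 u (Ioo t₀ t₁ ×ˢ (univ : Set (EuclideanSpace ℝ (Fin d)))))
    -- `u` solves the Hamilton–Jacobi equation there
    (hu_HJ : ∀ t ∈ Ioo t₀ t₁, ∀ y : EuclideanSpace ℝ (Fin d),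
      deriv (fun τ => u (τ, y)) t + H t y (gradient (fun y' => u (t, y')) y) = 0) :
    -- conclusion: `u` is differentiable with locally Lipschitz differential
    (∀ z : ℝ × EuclideanSpace ℝ (Fin d), z.1 ∈ Ioo t₀ t₁ → DifferentiableAt ℝ u z) ∧
    (∀ z : ℝ × EuclideanSpace ℝ (Fin d), z.1 ∈ Ioo t₀ t₁ →
      ∃ ε > 0, ball z ε ⊆ Ioo t₀ t₁ ×ˢ (univ : Set (EuclideanSpace ℝ (Fin d))) ∧
        ∃ K : ℝ≥0, LipschitzOnWith K (fun w => fderiv ℝ u w) (ball z ε)) := by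
  have hopen : IsOpen (Ioo t₀ t₁ ×ˢ (univ : Set (EuclideanSpace ℝ (Fin d)))) :=
    isOpen_Ioo.prod isOpen_univ
  have hdiff (z : ℝ × EuclideanSpace ℝ (Fin d)) (hz : z.1 ∈ Ioo t₀ t₁) :
      DifferentiableAt ℝ u z :=
    (hu_C1.differentiableOn (by norm_num)).differentiableAt (hopen.mem_nhds ⟨hz, mem_univ _⟩)
  refine ⟨hdiff, fun z hz => ?_⟩
  exact exists_lipschitzOnWith_fderiv (hH.of_le (by norm_num)) hm (hm.le.trans hmM)
    (le_secondDifference_hamiltonian hH hd2H hconv)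
    (p := fun z => gradient (fun y => u (z.1, y)) z.2)
    (hu_C1.continuousOn_fderiv_of_isOpen hopen (by norm_num))
    (fun w hw => hasFDerivAt_spacetimeForm_of_hamiltonJacobi (hdiff w hw) (hu_HJ w.1 hw w.2)) hz
end

section
/- Let H(t,q,p) : ℝ × ℝ^d × ℝ^d → ℝ be a C² Hamiltonian with ‖d²H(t,q,p)‖ ≤ M for all (t,q,p). Suppose given a family of operators T_τ^t, defined for 0 ≤ τ ≤ t, mapping functions ℝ^d → ℝ to functions ℝ^d → ℝ, satisfying: (Markov) T_s^t ∘ T_τ^s = T_τ^t whenever τ ≤ s ≤ t; (Monotony) if u ≥ v pointwise then T_τ^t u ≥ T_τ^t v pointwise for each t ≥ τ; (Compatibility with (HJ)) if v(t,q) : (a,b) × ℝ^d → ℝ is a C² solution of (HJ) and a < τ < t < b, then T_τ^t v_τ = v_t, where v_s := v(s,·); (Boundedness) if u_τ is Lipschitz in the large, then for each T' ≥ τ the functions T_τ^t u_τ, t ∈ [τ, T'], are uniformly Lipschitz in the large. Then for every initial condition u₀ : ℝ^d → ℝ which is Lipschitz in the large, the function u(t,q) := (T_0^t u₀)(q) is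 a viscosity solution of (HJ) on (0,∞) × ℝ^d. -/
open scoped RealInnerProductSpace
open Set

section

open Filter Topology

/-- A `C¹` map which is a contraction in its second variable, uniformly over an open set of
parameters, has a fixed point depending in a `C¹` way on the parameter. -/
theorem exists_contDiffOn_fixedPoint {X Y : Type*}
    [NormedAddCommGroup X] [NormedSpace ℝ X] [CompleteSpace X]
    [NormedAddCommGroup Y] [NormedSpace ℝ Y] [CompleteSpace Y]
    {Φ : X × Y → Y} (hΦ : ContDiff ℝ 1 Φ) {Ω : Set X} (hΩ : IsOpen Ω)
    (hLip : ∀ z ∈ Ω, ∀ y y', ‖Φ (z, y) - Φ (z, y')‖ ≤ 1 / 2 * ‖y - y'‖) :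
    ∃ γ : X → Y, (∀ z ∈ Ω, Φ (z, γ z) = γ z) ∧ ContDiffOn ℝ 1 γ Ω := by
  have hc : ∀ z ∈ Ω, ContractingWith (1 / 2) (fun y => Φ (z, y)) := fun z hz =>
    ⟨by rw [← NNReal.coe_lt_coe]; norm_num, LipschitzWith.of_dist_le_mul fun y y' => by
      simpa [dist_eq_norm] using hLip z hz y y'⟩
  have hex : ∀ z, ∃ y, z ∈ Ω → Φ (z, y) = y := fun z => by
    by_cases hz : z ∈ Ω
    · exact ⟨_, fun _ => (hc z hz).fixedPoint_isFixedPt⟩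
    · exact ⟨0, fun h => absurd h hz⟩
  choose γ hγ using hex
  refine ⟨γ, hγ, fun z hz => ContDiffAt.contDiffWithinAt ?_⟩
  have hf : ContDiff ℝ 1 (fun u : X × Y => u.2 - Φ u) := contDiff_snd.sub hΦ
  have cdf := hf.contDiffAt (x := (z, γ z))
  set B : Y →L[ℝ] Y := fderiv ℝ (fun y => Φ (z, y)) (γ z) with hB
  have hBn : ‖B‖ < 1 := by
    have := norm_fderiv_le_of_lipschitz ℝ (hc z hz).2 (x₀ := γ z)
    refine this.trans_lt ?_
    norm_num
  have hΦd : HasFDerivAt Φ (fderiv ℝ Φ (z, γ z)) (z, γ z) :=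
    (hΦ.differentiable one_ne_zero).differentiableAt.hasFDerivAt
  have hB' : B = fderiv ℝ Φ (z, γ z) ∘L .inr ℝ X Y :=
    (hΦd.comp (γ z) (hasFDerivAt_prodMk_right z (γ z))).fderiv
  have hinv : (fderiv ℝ (fun u : X × Y => u.2 - Φ u) (z, γ z) ∘L .inr ℝ X Y).IsInvertible := by
    have : fderiv ℝ (fun u : X × Y => u.2 - Φ u) (z, γ z) ∘L .inr ℝ X Y = 1 - B := by
      have h0 : HasFDerivAt (fun u : X × Y => u.2 - Φ u) _ (z, γ z) := hasFDerivAt_snd.sub hΦd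
      rw [h0.fderiv, hB']
      ext; simp
    rw [this]
    obtain ⟨w, hw⟩ := isUnit_one_sub_of_norm_lt_one hBn
    exact hw ▸ ContinuousLinearMap.isInvertible_equiv (f := ContinuousLinearEquiv.ofUnit w)
  have h1 := cdf.contDiffAt_implicitFunction one_ne_zero hinv
  refine h1.congr_of_eventuallyEq ?_
  filter_upwards [cdf.eventually_apply_implicitFunction one_ne_zero hinv, hΩ.mem_nhds hz]
    with x hx hxΩ
  rw [hγ z hz, sub_self, sub_eq_zero] at hx
  exact (hc x hxΩ).fixedPoint_unique' (hγ x hxΩ) hx.symm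

/-- Composition with a `C¹` map is a `C¹` operation on continuous functions on a compact space. -/
theorem contDiff_continuousMap_comp {K E F : Type*} [TopologicalSpace K] [CompactSpace K]
    [NormedAddCommGroup E] [NormedSpace ℝ E] [NormedAddCommGroup F] [NormedSpace ℝ F]
    {G : C(E, F)} (hG : ContDiff ℝ 1 G) : ContDiff ℝ 1 (fun γ : C(K, E) => G.comp γ) := by
  let app : C(K, E →L[ℝ] F) →L[ℝ] C(K, E) →L[ℝ] C(K, F) :=
    LinearMap.mkContinuous₂ (LinearMap.mk₂ ℝ
      (fun (A : C(K, E →L[ℝ] F)) (η : C(K, E)) => (⟨fun k => A k (η k), by fun_prop⟩ : C(K, F)))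
      (fun _ _ _ => by ext; simp) (fun _ _ _ => by ext; simp)
      (fun _ _ _ => by ext; simp) (fun _ _ _ => by ext; simp)) 1 fun A η => by
        rw [one_mul]
        refine (ContinuousMap.norm_le _ (by positivity)).2 fun k => ?_
        exact ((A k).le_opNorm _).trans
          (mul_le_mul (A.norm_coe_le_norm k) (η.norm_coe_le_norm k) (norm_nonneg _) (norm_nonneg A))
  have hdG : Continuous (fderiv ℝ G) := hG.continuous_fderiv one_ne_zero
  let dG : C(K, E) → C(K, E →L[ℝ] F) := fun γ => (⟨fderiv ℝ G, hdG⟩ : C(E, E →L[ℝ] F)).comp γ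
  have hdGc : Continuous dG := ContinuousMap.continuous_postcomp _
  rw [contDiff_one_iff_hasFDerivAt]
  refine ⟨fun γ => app (dG γ), app.continuous.comp hdGc, fun γ => ?_⟩
  rw [hasFDerivAt_iff_isLittleO, Asymptotics.isLittleO_iff]
  intro c hc
  have hn : dG ⁻¹' Metric.ball (dG γ) c ∈ 𝓝 γ :=
    hdGc.continuousAt (Metric.ball_mem_nhds (dG γ) hc : Metric.ball (dG γ) c ∈ 𝓝 (dG γ))
  obtain ⟨δ, hδ, hball⟩ := Metric.mem_nhds_iff.1 hn
  filter_upwards [Metric.ball_mem_nhds γ hδ] with γ' hγ'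
  refine (ContinuousMap.norm_le _ (by positivity)).2 fun k => ?_
  have key : ‖G (γ' k) - G (γ k) - fderiv ℝ G (γ k) (γ' k - γ k)‖ ≤ c * ‖γ' k - γ k‖ := by
    refine Convex.norm_image_sub_le_of_norm_fderiv_le' (𝕜 := ℝ) (s := segment ℝ (γ k) (γ' k))
      (fun x _ => (hG.differentiable one_ne_zero).differentiableAt) (fun x hx => ?_)
      (convex_segment _ _) (left_mem_segment _ _ _) (right_mem_segment _ _ _)
    rw [segment_eq_image'] at hx
    obtain ⟨θ, hθ, rfl⟩ := hx
    have hmem : dist (γ + θ • (γ' - γ)) γ < δ := by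
      rw [dist_eq_norm, add_sub_cancel_left, norm_smul]
      rw [Metric.mem_ball, dist_eq_norm] at hγ'
      refine lt_of_le_of_lt ?_ hγ'
      refine mul_le_of_le_one_left (norm_nonneg _) ?_
      rw [Real.norm_of_nonneg hθ.1]; exact hθ.2
    have h2 := (ContinuousMap.dist_apply_le_dist k).trans
      (Metric.mem_ball.1 (hball (Metric.mem_ball.2 hmem))).le
    rw [dist_eq_norm] at h2
    exact h2
  exact key.trans (mul_le_mul_of_nonneg_left ((γ' - γ).norm_coe_le_norm k) hc.le)

section CurveIntegral

variable {F : Type*} [NormedAddCommGroup F]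

/-- Extension of a continuous curve on `[-r, r]` to the real line by constants. -/
noncomputable def curveExtend (r : NNReal) (g : C(Icc (-r : ℝ) r, F)) : ℝ → F :=
  IccExtend (neg_le_self r.2) g

variable {r : NNReal}

@[fun_prop]
theorem continuous_curveExtend (g : C(Icc (-r : ℝ) r, F)) : Continuous (curveExtend r g) :=
  g.continuous.Icc_extend'

theorem curveExtend_of_mem (g : C(Icc (-r : ℝ) r, F)) {s : ℝ} (hs : s ∈ Icc (-r : ℝ) r) :
    curveExtend r g s = g ⟨s, hs⟩ :=
  IccExtend_of_mem _ _ hs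

theorem norm_curveExtend_le (g : C(Icc (-r : ℝ) r, F)) (s : ℝ) : ‖curveExtend r g s‖ ≤ ‖g‖ :=
  g.norm_coe_le_norm _

theorem continuous_curveExtend_uncurry :
    Continuous fun u : ℝ × C(Icc (-r : ℝ) r, F) => curveExtend r u.2 u.1 := by
  unfold curveExtend IccExtend
  have h : Continuous (projIcc (-r : ℝ) r (neg_le_self r.2)) := continuous_projIcc
  exact continuous_eval.comp (continuous_snd.prodMk (h.comp continuous_fst))

variable [NormedSpace ℝ F]

/-- The continuous linear map `g ↦ ∫ s in 0..t, g s` on curves. -/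
noncomputable def intervalIntegralCLM (r : NNReal) (F : Type*) [NormedAddCommGroup F]
    [NormedSpace ℝ F] (t : ℝ) : C(Icc (-r : ℝ) r, F) →L[ℝ] F :=
  LinearMap.mkContinuous
    { toFun := fun g => ∫ s in (0 : ℝ)..t, curveExtend r g s
      map_add' := fun f g => intervalIntegral.integral_add
        ((continuous_curveExtend f).intervalIntegrable _ _)
        ((continuous_curveExtend g).intervalIntegrable _ _)
      map_smul' := fun c f => intervalIntegral.integral_smul c _ } |t| fun g => by
    have := intervalIntegral.norm_integral_le_of_norm_le_const (a := 0) (b := t)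
      (f := curveExtend r g) (C := ‖g‖) fun s _ => norm_curveExtend_le g s
    rwa [sub_zero, mul_comm] at this

theorem intervalIntegralCLM_apply (t : ℝ) (g : C(Icc (-r : ℝ) r, F)) :
    intervalIntegralCLM r F t g = ∫ s in (0 : ℝ)..t, curveExtend r g s := rfl

theorem norm_intervalIntegralCLM_sub_apply_le (t t' : ℝ) (g : C(Icc (-r : ℝ) r, F)) :
    ‖intervalIntegralCLM r F t g - intervalIntegralCLM r F t' g‖ ≤ |t - t'| * ‖g‖ := by
  rw [intervalIntegralCLM_apply, intervalIntegralCLM_apply,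
    intervalIntegral.integral_interval_sub_left
    ((continuous_curveExtend g).intervalIntegrable _ _)
    ((continuous_curveExtend g).intervalIntegrable _ _), mul_comm]
  exact intervalIntegral.norm_integral_le_of_norm_le_const fun s _ => norm_curveExtend_le g s

theorem norm_intervalIntegralCLM_apply_le (t : ℝ) (g : C(Icc (-r : ℝ) r, F)) :
    ‖intervalIntegralCLM r F t g‖ ≤ |t| * ‖g‖ := by
  simpa [intervalIntegralCLM_apply] using norm_intervalIntegralCLM_sub_apply_le t 0 g

theorem continuous_intervalIntegralCLM : Continuous (intervalIntegralCLM r F) := by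
  suffices h : LipschitzWith 1 (intervalIntegralCLM r F) from h.continuous
  refine LipschitzWith.of_dist_le_mul fun t t' => ?_
  rw [dist_eq_norm, dist_eq_norm, NNReal.coe_one, one_mul]
  exact ContinuousLinearMap.opNorm_le_bound _ (norm_nonneg _) fun g =>
    norm_intervalIntegralCLM_sub_apply_le t t' g

theorem hasFDerivAt_intervalIntegralCLM [CompleteSpace F] (u : ℝ × C(Icc (-r : ℝ) r, F)) :
    HasFDerivAt (fun u : ℝ × C(Icc (-r : ℝ) r, F) => intervalIntegralCLM r F u.1 u.2)
      ((ContinuousLinearMap.toSpanSingleton ℝ (curveExtend r u.2 u.1)).coprod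
        (intervalIntegralCLM r F u.1)) u := by
  refine (hasStrictFDerivAt_uncurry_coprod (𝕜 := ℝ)
    (f := fun t g => intervalIntegralCLM r F t g)
    (f₁ := fun t g => ContinuousLinearMap.toSpanSingleton ℝ (curveExtend r g t))
    (f₂ := fun t _ => intervalIntegralCLM r F t)
    (Eventually.of_forall fun v => ?_) (Eventually.of_forall fun v => ?_) ?_ ?_).hasFDerivAt
  · exact ((continuous_curveExtend v.2).integral_hasStrictDerivAt 0 v.1).hasDerivAt.hasFDerivAt
  · exact (intervalIntegralCLM r F v.1).hasFDerivAt
  · exact ((ContinuousLinearMap.toSpanSingletonCLE (𝕜 := ℝ) (E := F)).continuous.comp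
      continuous_curveExtend_uncurry).continuousAt
  · exact (continuous_intervalIntegralCLM.comp continuous_fst).continuousAt

theorem contDiff_intervalIntegralCLM [CompleteSpace F] :
    ContDiff ℝ 1 (fun u : ℝ × C(Icc (-r : ℝ) r, F) => intervalIntegralCLM r F u.1 u.2) := by
  rw [contDiff_one_iff_hasFDerivAt]
  refine ⟨fun u => (ContinuousLinearMap.toSpanSingleton ℝ (curveExtend r u.2 u.1)).coprod
    (intervalIntegralCLM r F u.1), ?_, hasFDerivAt_intervalIntegralCLM⟩
  have h1 : Continuous fun u : ℝ × C(Icc (-r : ℝ) r, F) =>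
      ContinuousLinearMap.toSpanSingleton ℝ (curveExtend r u.2 u.1) :=
    (ContinuousLinearMap.toSpanSingletonCLE (𝕜 := ℝ) (E := F)).continuous.comp
      continuous_curveExtend_uncurry
  have h2 := (continuous_intervalIntegralCLM (r := r) (F := F)).comp
    (continuous_fst (X := ℝ) (Y := C(Icc (-r : ℝ) r, F)))
  exact (ContinuousLinearMap.coprodEquivL ℝ).continuous.comp (h1.prodMk h2)

/-- The continuous linear map sending a curve to its primitive vanishing at `0`. -/
noncomputable def curvePrimitive (r : NNReal) (F : Type*) [NormedAddCommGroup F] [NormedSpace ℝ F] :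
    C(Icc (-r : ℝ) r, F) →L[ℝ] C(Icc (-r : ℝ) r, F) :=
  LinearMap.mkContinuous
    { toFun := fun g => ⟨fun s => intervalIntegralCLM r F s g,
        (continuous_intervalIntegralCLM.comp continuous_subtype_val).clm_apply continuous_const⟩
      map_add' := fun f g => by ext; simp
      map_smul' := fun c f => by ext; simp } r fun g => by
    refine (ContinuousMap.norm_le _ (by positivity)).2 fun s => ?_
    exact (norm_intervalIntegralCLM_apply_le _ g).trans
      (mul_le_mul_of_nonneg_right (abs_le.2 s.2) (norm_nonneg _))

theorem curvePrimitive_apply (g : C(Icc (-r : ℝ) r, F)) (s : Icc (-r : ℝ) r) :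
    curvePrimitive r F g s = intervalIntegralCLM r F s g := rfl

theorem norm_curvePrimitive_apply_le (g : C(Icc (-r : ℝ) r, F)) :
    ‖curvePrimitive r F g‖ ≤ r * ‖g‖ :=
  (ContinuousMap.norm_le _ (by positivity)).2 fun s =>
      (norm_intervalIntegralCLM_apply_le _ g).trans
        (mul_le_mul_of_nonneg_right (abs_le.2 s.2) (norm_nonneg _))

end CurveIntegral

/-- Integration by parts for the inner product of two primitives. -/
theorem integral_inner_primitives {E : Type*} [NormedAddCommGroup E] [InnerProductSpace ℝ E]
    [CompleteSpace E] {f g : ℝ → E} (hf : Continuous f) (hg : Continuous g) (a b : E) (t : ℝ) :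
    ∫ s in (0 : ℝ)..t, (⟪a - ∫ σ in (0 : ℝ)..s, g σ, f s⟫ - ⟪g s, b + ∫ σ in (0 : ℝ)..s, f σ⟫) =
      ⟪a - ∫ σ in (0 : ℝ)..t, g σ, b + ∫ σ in (0 : ℝ)..t, f σ⟫ - ⟪a, b⟫ := by
  have hdf : ∀ s, HasDerivAt (fun s => b + ∫ σ in (0 : ℝ)..s, f σ) (f s) s := fun s =>
    (hf.integral_hasStrictDerivAt 0 s).hasDerivAt.const_add b
  have hdg : ∀ s, HasDerivAt (fun s => a - ∫ σ in (0 : ℝ)..s, g σ) (-g s) s := fun s =>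
    (hg.integral_hasStrictDerivAt 0 s).hasDerivAt.const_sub a
  have hcf : Continuous fun s => b + ∫ σ in (0 : ℝ)..s, f σ :=
    continuous_iff_continuousAt.2 fun s => (hdf s).continuousAt
  have hcg : Continuous fun s => a - ∫ σ in (0 : ℝ)..s, g σ :=
    continuous_iff_continuousAt.2 fun s => (hdg s).continuousAt
  have := intervalIntegral.integral_eq_sub_of_hasDerivAt (a := 0) (b := t)
    (f := fun s => ⟪a - ∫ σ in (0 : ℝ)..s, g σ, b + ∫ σ in (0 : ℝ)..s, f σ⟫)
    (f' := fun s => ⟪a - ∫ σ in (0 : ℝ)..s, g σ, f s⟫ - ⟪g s, b + ∫ σ in (0 : ℝ)..s, f σ⟫)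
    (fun s _ => by simpa [sub_eq_add_neg] using (hdg s).inner ℝ (hdf s))
    ((by fun_prop : Continuous _).intervalIntegrable _ _)
  simpa using this

section Characteristics

variable {E : Type*} [NormedAddCommGroup E] [InnerProductSpace ℝ E]

/-- The initial position of a trajectory of velocity `lam • γ.1` passing through `z.2` at
time `z.1`. -/
noncomputable def charStart (r : NNReal) (lam : ℝ) (z : ℝ × E)
    (γ : C(Icc (-r : ℝ) r, E) × C(Icc (-r : ℝ) r, E)) : E :=
  z.2 - lam • intervalIntegralCLM r E z.1 γ.1

/-- The curve in extended phase space of velocity `lam • γ.1` and momentum `γ.2`, passing above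
`z.2` at time `z.1`. -/
noncomputable def charCurve (r : NNReal) (lam : ℝ) (z : ℝ × E)
    (γ : C(Icc (-r : ℝ) r, E) × C(Icc (-r : ℝ) r, E)) : C(Icc (-r : ℝ) r, ℝ × E × E) :=
  ⟨fun s => (s, 0, 0), by fun_prop⟩ +
    ((ContinuousLinearMap.inr ℝ ℝ (E × E)) ∘L
      (ContinuousLinearMap.inl ℝ E E)).compLeftContinuous ℝ _
        (ContinuousLinearMap.const ℝ _ (charStart r lam z γ) + lam • curvePrimitive r E γ.1) +
    ((ContinuousLinearMap.inr ℝ ℝ (E × E)) ∘L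
      (ContinuousLinearMap.inr ℝ E E)).compLeftContinuous ℝ _ γ.2

/-- The map whose fixed points are the characteristics issued from the graph of `q ↦ K • q`. -/
noncomputable def charMap (r : NNReal) (lam K : ℝ) (Gq Gp : C(ℝ × E × E, E)) (z : ℝ × E)
    (γ : C(Icc (-r : ℝ) r, E) × C(Icc (-r : ℝ) r, E)) :
    C(Icc (-r : ℝ) r, E) × C(Icc (-r : ℝ) r, E) :=
  (lam⁻¹ • Gp.comp (charCurve r lam z γ),
    ContinuousLinearMap.const ℝ _ (K • charStart r lam z γ) -
      curvePrimitive r E (Gq.comp (charCurve r lam z γ)))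

variable {r : NNReal} {lam K : ℝ} {Gq Gp : C(ℝ × E × E, E)}

theorem charCurve_apply (z : ℝ × E) (γ : C(Icc (-r : ℝ) r, E) × C(Icc (-r : ℝ) r, E))
    (s : Icc (-r : ℝ) r) :
    charCurve r lam z γ s =
      ((s : ℝ), charStart r lam z γ + lam • intervalIntegralCLM r E s γ.1, γ.2 s) := by
  simp [charCurve, curvePrimitive_apply]

theorem contDiff_charStart [CompleteSpace E] : ContDiff ℝ 1 (fun u : (ℝ × E) ×
    (C(Icc (-r : ℝ) r, E) × C(Icc (-r : ℝ) r, E)) => charStart r lam u.1 u.2) := by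
  have h := (contDiff_intervalIntegralCLM (r := r) (F := E)).comp
    (f := fun u : (ℝ × E) × (C(Icc (-r : ℝ) r, E) × C(Icc (-r : ℝ) r, E)) => (u.1.1, u.2.1))
    (by fun_prop)
  exact (by fun_prop : ContDiff ℝ 1 _).sub (h.const_smul lam)

theorem contDiff_charCurve [CompleteSpace E] : ContDiff ℝ 1 (fun u : (ℝ × E) ×
    (C(Icc (-r : ℝ) r, E) × C(Icc (-r : ℝ) r, E)) => charCurve r lam u.1 u.2) := by
  refine (contDiff_const.add ((ContinuousLinearMap.contDiff _).comp
    (((ContinuousLinearMap.contDiff _).comp contDiff_charStart).add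
      (((curvePrimitive r E).contDiff.comp (contDiff_fst.comp contDiff_snd)).const_smul lam)))).add
    ((ContinuousLinearMap.contDiff _).comp (contDiff_snd.comp contDiff_snd))

theorem contDiff_charMap [CompleteSpace E] (hGq : ContDiff ℝ 1 Gq) (hGp : ContDiff ℝ 1 Gp) :
    ContDiff ℝ 1 (fun u : (ℝ × E) × (C(Icc (-r : ℝ) r, E) × C(Icc (-r : ℝ) r, E)) =>
      charMap r lam K Gq Gp u.1 u.2) :=
  (((contDiff_continuousMap_comp hGp).comp contDiff_charCurve).const_smul lam⁻¹).prodMk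
    (((ContinuousLinearMap.contDiff _).comp (contDiff_charStart.const_smul K)).sub
      ((curvePrimitive r E).contDiff.comp
        ((contDiff_continuousMap_comp hGq).comp contDiff_charCurve)))

theorem norm_charStart_sub_le (hlam : 0 < lam) {z : ℝ × E} (hz : |z.1| ≤ r)
    (γ γ' : C(Icc (-r : ℝ) r, E) × C(Icc (-r : ℝ) r, E)) :
    ‖charStart r lam z γ - charStart r lam z γ'‖ ≤ lam * (r * ‖γ - γ'‖) := by
  have : charStart r lam z γ - charStart r lam z γ' =
      -(lam • intervalIntegralCLM r E z.1 (γ.1 - γ'.1)) := by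
    simp only [charStart, map_sub, smul_sub]; abel
  rw [this, norm_neg, norm_smul, Real.norm_of_nonneg hlam.le]
  refine mul_le_mul_of_nonneg_left ((norm_intervalIntegralCLM_apply_le _ _).trans ?_) hlam.le
  exact mul_le_mul hz (norm_fst_le (γ - γ')) (norm_nonneg _) r.2

theorem norm_charCurve_sub_le (hlam : 0 < lam) (hr : 2 * r * lam ≤ 1) {z : ℝ × E}
    (hz : |z.1| ≤ r) (γ γ' : C(Icc (-r : ℝ) r, E) × C(Icc (-r : ℝ) r, E)) :
    ‖charCurve r lam z γ - charCurve r lam z γ'‖ ≤ ‖γ - γ'‖ := by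
  refine (ContinuousMap.norm_le _ (norm_nonneg _)).2 fun s => ?_
  rw [ContinuousMap.sub_apply, charCurve_apply, charCurve_apply, Prod.mk_sub_mk, Prod.mk_sub_mk,
    sub_self]
  refine norm_prod_le_iff.2 ⟨by simp, norm_prod_le_iff.2 ⟨?_, ?_⟩⟩
  · have : charStart r lam z γ + lam • intervalIntegralCLM r E s γ.1 -
        (charStart r lam z γ' + lam • intervalIntegralCLM r E s γ'.1) =
        (charStart r lam z γ - charStart r lam z γ') +
          lam • intervalIntegralCLM r E s (γ.1 - γ'.1) := by
      simp only [map_sub, smul_sub]; abel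
    have h2 : ‖lam • intervalIntegralCLM r E s (γ.1 - γ'.1)‖ ≤ lam * (r * ‖γ - γ'‖) := by
      rw [norm_smul, Real.norm_of_nonneg hlam.le]
      refine mul_le_mul_of_nonneg_left ((norm_intervalIntegralCLM_apply_le _ _).trans ?_) hlam.le
      exact mul_le_mul (abs_le.2 s.2) (norm_fst_le (γ - γ')) (norm_nonneg _) r.2
    simp only [this]
    refine (norm_add_le _ _).trans ((add_le_add (norm_charStart_sub_le hlam hz γ γ') h2).trans ?_)
    nlinarith [norm_nonneg (γ - γ')]
  · exact ((γ.2 - γ'.2).norm_coe_le_norm s).trans (norm_snd_le (γ - γ'))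

theorem norm_charMap_sub_le {M : ℝ} (hlam : 0 < lam) (hr : 2 * r * lam ≤ 1) (hM : 2 * M ≤ lam)
    (hK : 0 ≤ K) (hKr : 4 * K * lam * r ≤ 1) (hM0 : 0 ≤ M)
    (hGq : ∀ x y, ‖Gq x - Gq y‖ ≤ M * ‖x - y‖) (hGp : ∀ x y, ‖Gp x - Gp y‖ ≤ M * ‖x - y‖)
    {z : ℝ × E} (hz : |z.1| ≤ r) (γ γ' : C(Icc (-r : ℝ) r, E) × C(Icc (-r : ℝ) r, E)) :
    ‖charMap r lam K Gq Gp z γ - charMap r lam K Gq Gp z γ'‖ ≤ 1 / 2 * ‖γ - γ'‖ := by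
  have hcomp : ∀ N : C(ℝ × E × E, E), (∀ x y, ‖N x - N y‖ ≤ M * ‖x - y‖) →
      ‖N.comp (charCurve r lam z γ) - N.comp (charCurve r lam z γ')‖ ≤ M * ‖γ - γ'‖ := by
    intro N hN
    refine (ContinuousMap.norm_le _ (by positivity)).2 fun s => (hN _ _).trans ?_
    refine mul_le_mul_of_nonneg_left ?_ hM0
    exact (ContinuousMap.norm_coe_le_norm (charCurve r lam z γ - charCurve r lam z γ') s).trans
      (norm_charCurve_sub_le hlam hr hz γ γ')
  have hn := norm_nonneg (γ - γ')
  refine norm_prod_le_iff.2 ⟨?_, ?_⟩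
  · simp only [charMap, Prod.fst_sub, ← smul_sub]
    rw [norm_smul, norm_inv, Real.norm_of_nonneg hlam.le, inv_mul_le_iff₀ hlam]
    refine (hcomp Gp hGp).trans ?_
    nlinarith
  · have h1 : (charMap r lam K Gq Gp z γ - charMap r lam K Gq Gp z γ').2 =
        ContinuousLinearMap.const ℝ _ (K • (charStart r lam z γ - charStart r lam z γ')) -
        curvePrimitive r E (Gq.comp (charCurve r lam z γ) - Gq.comp (charCurve r lam z γ')) := by
      simp only [charMap, Prod.snd_sub, map_sub, smul_sub]; abel
    have h2 : ‖(ContinuousLinearMap.const ℝ (Icc (-r : ℝ) r)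
        (K • (charStart r lam z γ - charStart r lam z γ')) : C(Icc (-r : ℝ) r, E))‖ ≤
        K * (lam * (r * ‖γ - γ'‖)) := by
      refine (ContinuousMap.norm_le _ (by positivity)).2 fun s => ?_
      simp only [ContinuousLinearMap.const_apply_apply, norm_smul, Real.norm_of_nonneg hK]
      exact mul_le_mul_of_nonneg_left (norm_charStart_sub_le hlam hz γ γ') hK
    have h3 := (norm_curvePrimitive_apply_le
      (Gq.comp (charCurve r lam z γ) - Gq.comp (charCurve r lam z γ'))).trans
      (mul_le_mul_of_nonneg_left (hcomp Gq hGq) r.2)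
    rw [h1]
    refine (norm_sub_le _ _).trans ((add_le_add h2 h3).trans ?_)
    have h4 : (r : ℝ) * M ≤ 1 / 4 := by nlinarith [r.2]
    have h5 : (r : ℝ) * (M * ‖γ - γ'‖) ≤ 1 / 4 * ‖γ - γ'‖ := by nlinarith
    nlinarith

theorem norm_le_of_charMap_eq {M C : ℝ} (hlam : 0 < lam) (hr : 2 * r * lam ≤ 1) (hM : 2 * M ≤ lam)
    (hK : 0 ≤ K) (hKr : 4 * K * lam * r ≤ 1) (hM0 : 0 ≤ M) (hC : 0 ≤ C)
    (hGq : ∀ x y, ‖Gq x - Gq y‖ ≤ M * ‖x - y‖) (hGp : ∀ x y, ‖Gp x - Gp y‖ ≤ M * ‖x - y‖)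
    (hGqC : ∀ s : ℝ, |s| ≤ r → ‖Gq (s, 0, 0)‖ ≤ C) (hGpC : ∀ s : ℝ, |s| ≤ r → ‖Gp (s, 0, 0)‖ ≤ C)
    {t : ℝ} (ht : |t| ≤ r) {γ : C(Icc (-r : ℝ) r, E) × C(Icc (-r : ℝ) r, E)}
    (hγ : charMap r lam K Gq Gp (t, 0) γ = γ) : ‖γ‖ ≤ 2 * (C * (lam⁻¹ + r)) := by
  have h1 := norm_charMap_sub_le hlam hr hM hK hKr hM0 hGq hGp (z := (t, 0)) ht γ 0
  have hs : charStart r lam ((t, 0) : ℝ × E) 0 = 0 := by simp [charStart]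
  have hc : ∀ s, charCurve r lam ((t, 0) : ℝ × E) 0 s = ((s : ℝ), 0, 0) := fun s => by
    simp [charCurve_apply, hs]
  have h2 : ‖charMap r lam K Gq Gp (t, 0) 0‖ ≤ C * (lam⁻¹ + r) := by
    refine norm_prod_le_iff.2 ⟨?_, ?_⟩
    · refine (ContinuousMap.norm_le _ (by positivity)).2 fun s => ?_
      simp only [charMap, ContinuousMap.smul_apply, ContinuousMap.comp_apply, hc, norm_smul,
        norm_inv, Real.norm_of_nonneg hlam.le]
      have := mul_le_mul_of_nonneg_left (hGpC s (abs_le.2 s.2)) (inv_nonneg.2 hlam.le)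
      nlinarith [mul_nonneg hC r.2]
    · simp only [charMap, hs, smul_zero, map_zero, zero_sub, norm_neg]
      refine (norm_curvePrimitive_apply_le _).trans ?_
      have : ‖Gq.comp (charCurve r lam ((t, 0) : ℝ × E) 0)‖ ≤ C :=
        (ContinuousMap.norm_le _ hC).2 fun s => by
          rw [ContinuousMap.comp_apply, hc]; exact hGqC s (abs_le.2 s.2)
      nlinarith [mul_le_mul_of_nonneg_left this r.2, mul_nonneg hC (inv_nonneg.2 hlam.le)]
  rw [hγ, sub_zero] at h1
  have h3 := norm_le_norm_add_norm_sub' γ (charMap r lam K Gq Gp (t, 0) 0)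
  linarith

/-- The momentum at time `z.1` of a characteristic passing through `z.2` at time `z.1`. -/
noncomputable def charMomentum (r : NNReal) (lam K : ℝ) (Gq : C(ℝ × E × E, E)) (z : ℝ × E)
    (γ : C(Icc (-r : ℝ) r, E) × C(Icc (-r : ℝ) r, E)) : E :=
  K • charStart r lam z γ - intervalIntegralCLM r E z.1 (Gq.comp (charCurve r lam z γ))

theorem contDiff_charMomentum [CompleteSpace E] (hGq : ContDiff ℝ 1 Gq) :
    ContDiff ℝ 1 (fun u : (ℝ × E) ×
    (C(Icc (-r : ℝ) r, E) × C(Icc (-r : ℝ) r, E)) => charMomentum r lam K Gq u.1 u.2) :=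
  (contDiff_charStart.const_smul K).sub (contDiff_intervalIntegralCLM.comp
    ((contDiff_fst.comp contDiff_fst).prodMk
      ((contDiff_continuousMap_comp hGq).comp contDiff_charCurve)))

theorem momentum_eq_of_charMap_eq {z : ℝ × E}
    {γ : C(Icc (-r : ℝ) r, E) × C(Icc (-r : ℝ) r, E)} (hγ : charMap r lam K Gq Gp z γ = γ)
    (s : Icc (-r : ℝ) r) :
    γ.2 s = K • charStart r lam z γ -
      intervalIntegralCLM r E s (Gq.comp (charCurve r lam z γ)) := by
  conv_lhs => rw [← hγ]
  simp [charMap, curvePrimitive_apply]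

theorem velocity_eq_of_charMap_eq (hlam : 0 < lam) {z : ℝ × E}
    {γ : C(Icc (-r : ℝ) r, E) × C(Icc (-r : ℝ) r, E)} (hγ : charMap r lam K Gq Gp z γ = γ)
    (s : Icc (-r : ℝ) r) : lam • γ.1 s = Gp (charCurve r lam z γ s) := by
  conv_lhs => rw [← hγ]
  simp [charMap, smul_smul, hlam.ne']

/-- The Lagrangian `⟪p, ẋ⟫ - G` along a curve in phase space. -/
noncomputable def charLagrangian (r : NNReal) (lam : ℝ) (G : C(ℝ × E × E, ℝ)) (z : ℝ × E)
    (γ : C(Icc (-r : ℝ) r, E) × C(Icc (-r : ℝ) r, E)) : C(Icc (-r : ℝ) r, ℝ) :=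
  (⟨fun w : (ℝ × E × E) × E => lam * ⟪w.1.2.2, w.2⟫ - G w.1, by fun_prop⟩ :
    C((ℝ × E × E) × E, ℝ)).comp
      ((ContinuousLinearMap.inl ℝ (ℝ × E × E) E).compLeftContinuous ℝ _ (charCurve r lam z γ) +
        (ContinuousLinearMap.inr ℝ (ℝ × E × E) E).compLeftContinuous ℝ _ γ.1)

/-- The action of a curve in phase space, for the initial condition `q ↦ K / 2 * ‖q‖ ^ 2`. -/
noncomputable def charAction (r : NNReal) (lam K : ℝ) (G : C(ℝ × E × E, ℝ)) (z : ℝ × E)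
    (γ : C(Icc (-r : ℝ) r, E) × C(Icc (-r : ℝ) r, E)) : ℝ :=
  K / 2 * ‖charStart r lam z γ‖ ^ 2 + intervalIntegralCLM r ℝ z.1 (charLagrangian r lam G z γ)

variable {G : C(ℝ × E × E, ℝ)}

theorem charLagrangian_apply (z : ℝ × E) (γ : C(Icc (-r : ℝ) r, E) × C(Icc (-r : ℝ) r, E))
    (s : Icc (-r : ℝ) r) : charLagrangian r lam G z γ s =
      lam * ⟪γ.2 s, γ.1 s⟫ - G (s, charStart r lam z γ + lam • intervalIntegralCLM r E s γ.1, γ.2 s)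
      := by
  simp [charLagrangian, charCurve_apply]

theorem contDiff_charLagrangian [CompleteSpace E] (hG : ContDiff ℝ 1 G) :
    ContDiff ℝ 1 (fun u : (ℝ × E) ×
    (C(Icc (-r : ℝ) r, E) × C(Icc (-r : ℝ) r, E)) => charLagrangian r lam G u.1 u.2) := by
  have hc := contDiff_charCurve (E := E) (r := r) (lam := lam)
  refine (contDiff_continuousMap_comp ?_).comp
    (((ContinuousLinearMap.contDiff _).comp hc).add
      ((ContinuousLinearMap.contDiff _).comp (contDiff_fst.comp contDiff_snd)))
  have h1 : ContDiff ℝ 1 fun w : (ℝ × E × E) × E => lam * ⟪w.1.2.2, w.2⟫ :=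
    contDiff_const.mul (ContDiff.inner ℝ (by fun_prop) (by fun_prop))
  exact h1.sub (hG.comp contDiff_fst)

theorem exists_hasFDerivAt_charStart [CompleteSpace E]
    {γ : ℝ × E → C(Icc (-r : ℝ) r, E) × C(Icc (-r : ℝ) r, E)}
    {z : ℝ × E} {Γ : ℝ × E →L[ℝ] C(Icc (-r : ℝ) r, E) × C(Icc (-r : ℝ) r, E)}
    (hΓ : HasFDerivAt γ Γ z) : ∃ y' : ℝ × E →L[ℝ] E,
      HasFDerivAt (fun z => charStart r lam z (γ z)) y' z ∧
      ∀ w, y' w = w.2 - lam • (w.1 • curveExtend r (γ z).1 z.1 +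
        intervalIntegralCLM r E z.1 (Γ w).1) := by
  refine ⟨_, hasFDerivAt_snd.sub (((hasFDerivAt_intervalIntegralCLM (z.1, (γ z).1)).comp z
    (hasFDerivAt_fst.prodMk hΓ.fst)).const_smul lam), fun w => ?_⟩
  simp

theorem exists_hasFDerivAt_charLagrangian [CompleteSpace E] (hlam : 0 < lam) (hG : ContDiff ℝ 1 G)
    (hder : ∀ s x p, HasFDerivAt (fun w : E × E => G (s, w.1, w.2))
      ((innerSL ℝ (Gq (s, x, p))).coprod (innerSL ℝ (Gp (s, x, p)))) (x, p))
    {γ : ℝ × E → C(Icc (-r : ℝ) r, E) × C(Icc (-r : ℝ) r, E)} {z : ℝ × E}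
    (hγ : charMap r lam K Gq Gp z (γ z) = γ z)
    {Γ : ℝ × E →L[ℝ] C(Icc (-r : ℝ) r, E) × C(Icc (-r : ℝ) r, E)} (hΓ : HasFDerivAt γ Γ z)
    {y' : ℝ × E →L[ℝ] E} (hy : HasFDerivAt (fun z => charStart r lam z (γ z)) y' z) :
    ∃ L' : ℝ × E →L[ℝ] C(Icc (-r : ℝ) r, ℝ),
      HasFDerivAt (fun z => charLagrangian r lam G z (γ z)) L' z ∧
      ∀ (s : Icc (-r : ℝ) r) (w : ℝ × E), L' w s = lam * ⟪(γ z).2 s, (Γ w).1 s⟫ -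
        ⟪Gq (charCurve r lam z (γ z) s), y' w + lam • intervalIntegralCLM r E s (Γ w).1⟫ := by
  have hc := (contDiff_charLagrangian (r := r) (lam := lam) hG).differentiable one_ne_zero
  have hLd : DifferentiableAt ℝ (fun z => charLagrangian r lam G z (γ z)) z :=
    DifferentiableAt.comp (g := fun u : (ℝ × E) × (C(Icc (-r : ℝ) r, E) × C(Icc (-r : ℝ) r, E)) =>
      charLagrangian r lam G u.1 u.2) (f := fun z => (z, γ z)) z hc.differentiableAt
      (differentiableAt_id.prodMk hΓ.differentiableAt)
  obtain ⟨L', hL⟩ := hLd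
  refine ⟨L', hL, fun s w => ?_⟩
  have h1 : HasFDerivAt (fun z => charLagrangian r lam G z (γ z) s)
      (ContinuousMap.evalCLM ℝ s ∘L L') z :=
    HasFDerivAt.comp (g := fun f : C(Icc (-r : ℝ) r, ℝ) => f s) z
      (ContinuousMap.evalCLM ℝ s : C(Icc (-r : ℝ) r, ℝ) →L[ℝ] ℝ).hasFDerivAt hL
  have hζ : HasFDerivAt (fun z => (γ z).1 s)
      (ContinuousMap.evalCLM ℝ s ∘L ContinuousLinearMap.fst ℝ _ _ ∘L Γ) z :=
    HasFDerivAt.comp (g := fun f : C(Icc (-r : ℝ) r, E) => f s) z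
      (ContinuousMap.evalCLM ℝ s : C(Icc (-r : ℝ) r, E) →L[ℝ] E).hasFDerivAt hΓ.fst
  have hp : HasFDerivAt (fun z => (γ z).2 s)
      (ContinuousMap.evalCLM ℝ s ∘L ContinuousLinearMap.snd ℝ _ _ ∘L Γ) z :=
    HasFDerivAt.comp (g := fun f : C(Icc (-r : ℝ) r, E) => f s) z
      (ContinuousMap.evalCLM ℝ s : C(Icc (-r : ℝ) r, E) →L[ℝ] E).hasFDerivAt hΓ.snd
  have hx : HasFDerivAt (fun z => charStart r lam z (γ z) +
      lam • intervalIntegralCLM r E s (γ z).1)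
      (y' + lam • (intervalIntegralCLM r E s ∘L ContinuousLinearMap.fst ℝ _ _ ∘L Γ)) z :=
    hy.add (((intervalIntegralCLM r E s).hasFDerivAt.comp z hΓ.fst).const_smul lam)
  have hxp := HasFDerivAt.comp z (hder s (charStart r lam z (γ z) +
    lam • intervalIntegralCLM r E s (γ z).1) ((γ z).2 s)) (hx.prodMk hp)
  have h2 := ((hp.inner ℝ hζ).const_mul lam).sub hxp
  have h3 := h1.unique (h2.congr_of_eventuallyEq
    (Eventually.of_forall fun z => charLagrangian_apply z (γ z) s))
  have h4 := congrArg (fun A => A w) h3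
  have h5 := velocity_eq_of_charMap_eq hlam hγ s
  rw [charCurve_apply] at h5 ⊢
  simp only [ContinuousLinearMap.comp_apply, ContinuousMap.evalCLM_apply] at h4
  rw [h4]
  simp only [sub_apply, _root_.smul_apply,
    ContinuousLinearMap.comp_apply, ContinuousLinearMap.prod_apply, fderivInnerCLM_apply,
    ContinuousLinearMap.coprod_apply, innerSL_apply_apply, add_apply,
    ContinuousMap.evalCLM_apply, ContinuousLinearMap.coe_fst', ContinuousLinearMap.coe_snd', ← h5,
    real_inner_smul_left, smul_eq_mul]
  rw [real_inner_comm ((Γ w).2 s) ((γ z).1 s)]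
  ring

/-- The differential of the action along a family of characteristics. -/
theorem hasFDerivAt_charAction [CompleteSpace E] (hlam : 0 < lam) (hG : ContDiff ℝ 1 G)
    (hder : ∀ s x p, HasFDerivAt (fun w : E × E => G (s, w.1, w.2))
      ((innerSL ℝ (Gq (s, x, p))).coprod (innerSL ℝ (Gp (s, x, p)))) (x, p))
    {γ : ℝ × E → C(Icc (-r : ℝ) r, E) × C(Icc (-r : ℝ) r, E)} {z : ℝ × E} (hz : |z.1| ≤ r)
    (hγ : charMap r lam K Gq Gp z (γ z) = γ z) (hd : DifferentiableAt ℝ γ z) :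
    HasFDerivAt (fun z => charAction r lam K G z (γ z))
      ((ContinuousLinearMap.toSpanSingleton ℝ
        (-G (z.1, z.2, charMomentum r lam K Gq z (γ z)))).coprod
          (innerSL ℝ (charMomentum r lam K Gq z (γ z)))) z := by
  obtain ⟨Γ, hΓ⟩ := hd
  obtain ⟨y', hy, hy'⟩ := exists_hasFDerivAt_charStart (lam := lam) hΓ
  obtain ⟨L', hL, hL'⟩ := exists_hasFDerivAt_charLagrangian hlam hG hder hγ hΓ hy
  have hv := ((hy.norm_sq).const_mul (K / 2)).add
    ((hasFDerivAt_intervalIntegralCLM (z.1, charLagrangian r lam G z (γ z))).comp z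
      (hasFDerivAt_fst.prodMk hL))
  refine HasFDerivAt.congr_fderiv hv (ContinuousLinearMap.ext fun w => ?_)
  have hzm : z.1 ∈ Icc (-r : ℝ) r := abs_le.1 hz
  set P := charMomentum r lam K Gq z (γ z) with hP
  set g := Gq.comp (charCurve r lam z (γ z)) with hg
  have hpt : (γ z).2 ⟨z.1, hzm⟩ = P := momentum_eq_of_charMap_eq hγ _
  have hLt : curveExtend r (charLagrangian r lam G z (γ z)) z.1 =
      lam * ⟪P, curveExtend r (γ z).1 z.1⟫ - G (z.1, z.2, P) := by
    rw [curveExtend_of_mem _ hzm, curveExtend_of_mem _ hzm, charLagrangian_apply, hpt]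
    simp [charStart]
  have hint : intervalIntegralCLM r ℝ z.1 (L' w) =
      ⟪P, w.2 - (lam * w.1) • curveExtend r (γ z).1 z.1⟫ -
        ⟪K • charStart r lam z (γ z), y' w⟫ := by
    have h1 := integral_inner_primitives
      ((continuous_curveExtend (Γ w).1).const_smul lam) (continuous_curveExtend g)
      (K • charStart r lam z (γ z)) (y' w) z.1
    simp only [Pi.smul_apply, intervalIntegral.integral_smul, ← intervalIntegralCLM_apply] at h1
    have h2 : y' w + lam • intervalIntegralCLM r E z.1 (Γ w).1 =
        w.2 - (lam * w.1) • curveExtend r (γ z).1 z.1 := by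
      rw [hy', smul_add, smul_smul]; abel
    rw [h2] at h1
    rw [hP, charMomentum, ← hg, ← h1, intervalIntegralCLM_apply]
    refine intervalIntegral.integral_congr fun s hs => ?_
    have hsm : s ∈ Icc (-r : ℝ) r :=
      uIcc_subset_Icc ⟨neg_nonpos.2 r.2, r.2⟩ hzm hs
    simp only [curveExtend_of_mem _ hsm, hL', real_inner_smul_right]
    rw [momentum_eq_of_charMap_eq hγ]
    rfl
  simp only [add_apply, _root_.smul_apply,
    ContinuousLinearMap.comp_apply, ContinuousLinearMap.prod_apply,
    ContinuousLinearMap.coprod_apply, ContinuousLinearMap.toSpanSingleton_apply,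
    innerSL_apply_apply, ContinuousLinearMap.coe_fst', hint, hLt, real_inner_smul_left,
    inner_sub_right, real_inner_smul_right, smul_eq_mul]
  ring
end Characteristics

theorem contDiffOn_two_of_hasFDerivAt_coprod {E : Type*} [NormedAddCommGroup E]
    [InnerProductSpace ℝ E] {v : ℝ × E → ℝ} {a : ℝ × E → ℝ} {P : ℝ × E → E} {Ω : Set (ℝ × E)}
    (hΩ : IsOpen Ω) (ha : ContDiffOn ℝ 1 a Ω) (hP : ContDiffOn ℝ 1 P Ω)
    (hv : ∀ z ∈ Ω, HasFDerivAt v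
      ((ContinuousLinearMap.toSpanSingleton ℝ (a z)).coprod (innerSL ℝ (P z))) z) :
    ContDiffOn ℝ 2 v Ω := by
  rw [show (2 : WithTop ℕ∞) = 1 + 1 from (one_add_one_eq_two).symm,
    contDiffOn_succ_iff_fderiv_of_isOpen hΩ]
  refine ⟨fun z hz => (hv z hz).differentiableAt.differentiableWithinAt, by simp, ?_⟩
  have h : ContDiffOn ℝ 1 (fun z => a z • ContinuousLinearMap.fst ℝ ℝ E +
      (innerSL ℝ (P z)) ∘L ContinuousLinearMap.snd ℝ ℝ E) Ω :=
    ((ContinuousLinearMap.toSpanSingleton ℝ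
      (ContinuousLinearMap.fst ℝ ℝ E)).contDiff.comp_contDiffOn ha).add
      (((innerSL ℝ).contDiff.comp_contDiffOn hP).clm_comp contDiffOn_const)
  refine h.congr fun z hz => ?_
  rw [(hv z hz).fderiv]
  ext w <;> simp [mul_comm]

/-- The method of characteristics: existence on an explicit time interval of a `C²` solution of
the Hamilton–Jacobi equation whose value at time `0` is `q ↦ K / 2 * ‖q‖ ^ 2`. -/
theorem exists_contDiffOn_solution {E : Type*} [NormedAddCommGroup E] [InnerProductSpace ℝ E]
    [CompleteSpace E] {r : NNReal} {lam K M C : ℝ} {G : C(ℝ × E × E, ℝ)} {Gq Gp : C(ℝ × E × E, E)}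
    (hlam : 0 < lam) (hr : 2 * r * lam ≤ 1) (hM : 2 * M ≤ lam)
    (hK : 0 ≤ K) (hKr : 4 * K * lam * r ≤ 1) (hM0 : 0 ≤ M) (hC : 0 ≤ C)
    (hG1 : ContDiff ℝ 1 G) (hGq1 : ContDiff ℝ 1 Gq) (hGp1 : ContDiff ℝ 1 Gp)
    (hder : ∀ s x p, HasFDerivAt (fun w : E × E => G (s, w.1, w.2))
      ((innerSL ℝ (Gq (s, x, p))).coprod (innerSL ℝ (Gp (s, x, p)))) (x, p))
    (hGq : ∀ x y, ‖Gq x - Gq y‖ ≤ M * ‖x - y‖) (hGp : ∀ x y, ‖Gp x - Gp y‖ ≤ M * ‖x - y‖)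
    (hGqC : ∀ s : ℝ, |s| ≤ r → ‖Gq (s, 0, 0)‖ ≤ C)
    (hGpC : ∀ s : ℝ, |s| ≤ r → ‖Gp (s, 0, 0)‖ ≤ C) :
    ∃ (v : ℝ × E → ℝ) (P : ℝ × E → E),
      ContDiffOn ℝ 2 v (Ioo (-r : ℝ) r ×ˢ univ) ∧
      (∀ z ∈ Ioo (-r : ℝ) r ×ˢ (univ : Set E), HasFDerivAt v
        ((ContinuousLinearMap.toSpanSingleton ℝ (-G (z.1, z.2, P z))).coprod
          (innerSL ℝ (P z))) z) ∧
      (∀ q, v (0, q) = K / 2 * ‖q‖ ^ 2) ∧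
      ∀ t ∈ Ioo (-r : ℝ) r, ‖P (t, 0)‖ ≤ 2 * (C * (lam⁻¹ + r)) := by
  have hΩ : IsOpen (Ioo (-r : ℝ) r ×ˢ (univ : Set E)) := isOpen_Ioo.prod isOpen_univ
  have habs : ∀ z ∈ Ioo (-r : ℝ) r ×ˢ (univ : Set E), |z.1| ≤ r := fun z hz =>
    (abs_lt.2 hz.1).le
  obtain ⟨γ, hγ, hγ1⟩ := exists_contDiffOn_fixedPoint
    (contDiff_charMap (r := r) (lam := lam) (K := K) hGq1 hGp1) hΩ fun z hz =>
      norm_charMap_sub_le hlam hr hM hK hKr hM0 hGq hGp (habs z hz)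
  have hP : ContDiffOn ℝ 1 (fun z => charMomentum r lam K Gq z (γ z))
      (Ioo (-r : ℝ) r ×ˢ (univ : Set E)) :=
    (contDiff_charMomentum hGq1).comp_contDiffOn (contDiffOn_id.prodMk hγ1)
  have hv : ∀ z ∈ Ioo (-r : ℝ) r ×ˢ (univ : Set E), HasFDerivAt _ _ z := fun z hz =>
    hasFDerivAt_charAction hlam hG1 hder (habs z hz) (hγ z hz)
      ((hγ1.differentiableOn one_ne_zero).differentiableAt (hΩ.mem_nhds hz))
  refine ⟨fun z => charAction r lam K G z (γ z), fun z => charMomentum r lam K Gq z (γ z),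
    contDiffOn_two_of_hasFDerivAt_coprod hΩ ?_ hP hv, hv, fun q => ?_, fun t ht => ?_⟩
  · exact (hG1.comp_contDiffOn (contDiffOn_fst.prodMk (contDiffOn_snd.prodMk hP))).neg
  · simp [charAction, charStart, intervalIntegralCLM_apply]
  · have hz : ((t, 0) : ℝ × E) ∈ Ioo (-r : ℝ) r ×ˢ (univ : Set E) := ⟨ht, mem_univ _⟩
    have h1 := norm_le_of_charMap_eq hlam hr hM hK hKr hM0 hC hGq hGp hGqC hGpC (habs _ hz)
      (hγ _ hz)
    have h2 := momentum_eq_of_charMap_eq (hγ _ hz) ⟨t, Ioo_subset_Icc_self ht⟩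
    change ‖charMomentum r lam K Gq (t, 0) (γ (t, 0))‖ ≤ _
    rw [charMomentum, ← h2]
    exact ((ContinuousMap.norm_coe_le_norm _ _).trans (norm_snd_le _)).trans h1

theorem exists_inner_eq_comp {E F : Type*} [NormedAddCommGroup E] [InnerProductSpace ℝ E]
    [CompleteSpace E] [NormedAddCommGroup F] [NormedSpace ℝ F] {J : E →L[ℝ] F} (hJ : ‖J‖ ≤ 1) :
    ∃ A : (F →L[ℝ] ℝ) →L[ℝ] E, (∀ L, innerSL ℝ (A L) = L ∘L J) ∧ ∀ L, ‖A L‖ ≤ ‖L‖ := by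
  have hle : ∀ L : F →L[ℝ] ℝ, ‖(InnerProductSpace.toDual ℝ E).symm (L ∘L J)‖ ≤ 1 * ‖L‖ :=
    fun L => by
      rw [LinearIsometryEquiv.norm_map, one_mul]
      exact (L.opNorm_comp_le J).trans (mul_le_of_le_one_right (norm_nonneg _) hJ)
  refine ⟨LinearMap.mkContinuous
    { toFun := fun L => (InnerProductSpace.toDual ℝ E).symm (L ∘L J)
      map_add' := fun L L' => by rw [ContinuousLinearMap.add_comp, map_add]
      map_smul' := fun c L => by simp [ContinuousLinearMap.smul_comp] } 1 hle,
    fun L => ?_, fun L => ?_⟩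
  · ext w
    simp
  · simpa using hle L

/-- Existence of a `C²` solution of the Hamilton–Jacobi equation with a given quadratic function
as its value at time `S`. -/
theorem exists_local_solution {E : Type*} [NormedAddCommGroup E] [InnerProductSpace ℝ E]
    [CompleteSpace E] {h : ℝ × E × E → ℝ} {lam K M C r : ℝ}
    (hh : ContDiff ℝ 2 h) (hM0 : 0 ≤ M)
    (hd : ∀ x y, ‖fderiv ℝ h x - fderiv ℝ h y‖ ≤ M * ‖x - y‖)
    (hr0 : 0 ≤ r) (hlam : 0 < lam) (hr : 2 * r * lam ≤ 1) (hM : 2 * M ≤ lam)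
    (hK : 0 ≤ K) (hKr : 4 * K * lam * r ≤ 1) (hC : 0 ≤ C) {S : ℝ} {Q p : E}
    (hhC : ∀ s, |s| ≤ r → ‖fderiv ℝ h (S + s, Q, p)‖ ≤ C) (A : ℝ) :
    ∃ v : ℝ × E → ℝ, ContDiffOn ℝ 2 v (Ioo (S - r) (S + r) ×ˢ univ) ∧
      (∀ t ∈ Ioo (S - r) (S + r), ∀ y,
        deriv (fun σ => v (σ, y)) t + h (t, y, gradient (fun y' => v (t, y')) y) = 0) ∧
      (∀ q, v (S, q) = A + ⟪p, q - Q⟫ + K / 2 * ‖q - Q‖ ^ 2) ∧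
      ∀ t ∈ Ioo (S - r) (S + r), ∃ π : E, ‖π‖ ≤ 2 * (C * (lam⁻¹ + r)) ∧
        HasDerivAt (fun σ => v (σ, Q)) (-h (t, Q, p + π)) t := by
  lift r to NNReal using hr0
  have hJ1 : ‖(ContinuousLinearMap.inr ℝ ℝ (E × E)) ∘L (ContinuousLinearMap.inl ℝ E E)‖ ≤ 1 :=
    ContinuousLinearMap.opNorm_le_bound _ zero_le_one fun x => by simp
  have hJ2 : ‖(ContinuousLinearMap.inr ℝ ℝ (E × E)) ∘L (ContinuousLinearMap.inr ℝ E E)‖ ≤ 1 :=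
    ContinuousLinearMap.opNorm_le_bound _ zero_le_one fun x => by simp
  obtain ⟨A1, hA1, hA1n⟩ := exists_inner_eq_comp hJ1
  obtain ⟨A2, hA2, hA2n⟩ := exists_inner_eq_comp hJ2
  have hh1 : ContDiff ℝ 1 (fun x : ℝ × E × E => fderiv ℝ h ((S, Q, p) + x)) :=
    (hh.fderiv_right (by norm_num [one_add_one_eq_two])).comp (contDiff_const.add contDiff_id)
  have hg1 : ∀ B : (ℝ × E × E →L[ℝ] ℝ) →L[ℝ] E,
      ContDiff ℝ 1 (fun x : ℝ × E × E => B (fderiv ℝ h ((S, Q, p) + x))) := fun B =>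
    hh1.continuousLinearMap_comp B
  have hG1 : ContDiff ℝ 1 (fun x : ℝ × E × E => h ((S, Q, p) + x)) :=
    (hh.of_le (by norm_num)).comp (contDiff_const.add contDiff_id)
  have hlip : ∀ B : (ℝ × E × E →L[ℝ] ℝ) →L[ℝ] E, (∀ L, ‖B L‖ ≤ ‖L‖) → ∀ x y,
      ‖B (fderiv ℝ h ((S, Q, p) + x)) - B (fderiv ℝ h ((S, Q, p) + y))‖ ≤ M * ‖x - y‖ :=
    fun B hB x y => by
      rw [← map_sub]
      simpa using (hB _).trans (hd ((S, Q, p) + x) ((S, Q, p) + y))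
  have hbd : ∀ B : (ℝ × E × E →L[ℝ] ℝ) →L[ℝ] E, (∀ L, ‖B L‖ ≤ ‖L‖) → ∀ s : ℝ, |s| ≤ r →
      ‖B (fderiv ℝ h ((S, Q, p) + (s, 0, 0)))‖ ≤ C := fun B hB s hs => by
    simpa using (hB _).trans (hhC s hs)
  obtain ⟨w, P, hw2, hwd, hw0, hPb⟩ := exists_contDiffOn_solution
    (G := ⟨fun x => h ((S, Q, p) + x), hG1.continuous⟩)
    (Gq := ⟨fun x => A1 (fderiv ℝ h ((S, Q, p) + x)), (hg1 A1).continuous⟩)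
    (Gp := ⟨fun x => A2 (fderiv ℝ h ((S, Q, p) + x)), (hg1 A2).continuous⟩)
    hlam hr hM hK hKr hM0 hC hG1 (hg1 A1) (hg1 A2) (fun s x π => by
      have h1 : HasFDerivAt (fun y : E × E => (S, Q, p) + (s, y.1, y.2))
          (ContinuousLinearMap.inr ℝ ℝ (E × E)) (x, π) :=
        (hasFDerivAt_prodMk_right s (x, π)).const_add _
      have h2 := HasFDerivAt.comp (x, π)
        ((hh.differentiable two_ne_zero) ((S, Q, p) + (s, x, π))).hasFDerivAt h1
      refine h2.congr_fderiv ?_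
      simp only [ContinuousMap.coe_mk, hA1, hA2]
      ext y <;> simp) (hlip A1 hA1n) (hlip A2 hA2n) (hbd A1 hA1n) (hbd A2 hA2n)
  have hsub : ∀ t ∈ Ioo (S - r) (S + r), t - S ∈ Ioo (-r : ℝ) r := fun t ht =>
    ⟨by linarith [ht.1], by linarith [ht.2]⟩
  have hvt : ∀ t ∈ Ioo (S - r) (S + r), ∀ y, HasDerivAt
      (fun σ => A + ⟪p, y - Q⟫ + w (σ - S, y - Q)) (-h (t, y, p + P (t - S, y - Q))) t :=
    fun t ht y => by
      have h1 : HasDerivAt (fun σ : ℝ => (σ - S, y - Q)) (1, 0) t :=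
        ((hasDerivAt_id t).sub_const S).prodMk (hasDerivAt_const t (y - Q))
      have h2 := (HasFDerivAt.comp_hasDerivAt t (hwd (t - S, y - Q) ⟨hsub t ht, mem_univ _⟩)
        h1).const_add (A + ⟪p, y - Q⟫)
      refine h2.congr_deriv ?_
      simp
  have hvy : ∀ t ∈ Ioo (S - r) (S + r), ∀ y, HasGradientAt
      (fun y' => A + ⟪p, y' - Q⟫ + w (t - S, y' - Q)) (p + P (t - S, y - Q)) y :=
    fun t ht y => by
      have h1 : HasFDerivAt (fun y' : E => (t - S, y' - Q)) (ContinuousLinearMap.inr ℝ ℝ E) y :=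
        (hasFDerivAt_const (t - S) y).prodMk ((hasFDerivAt_id y).sub_const Q)
      have h2 := HasFDerivAt.comp y (hwd (t - S, y - Q) ⟨hsub t ht, mem_univ _⟩) h1
      have h3 := (((innerSL ℝ p).hasFDerivAt.comp y
        ((hasFDerivAt_id y).sub_const Q)).const_add A).add h2
      refine h3.congr_fderiv ?_
      ext y'
      simp
  refine ⟨fun z => A + ⟪p, z.2 - Q⟫ + w (z.1 - S, z.2 - Q), ?_, fun t ht y => ?_, fun q => ?_,
    fun t ht => ⟨P (t - S, 0), hPb _ (hsub t ht), by simpa using hvt t ht Q⟩⟩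
  · refine ContDiffOn.add (ContDiff.contDiffOn ?_) (hw2.comp (ContDiff.contDiffOn ?_)
      fun z hz => ⟨hsub _ hz.1, mem_univ _⟩)
    · exact contDiff_const.add (contDiff_const.inner ℝ (contDiff_snd.sub contDiff_const))
    · fun_prop
  · rw [(hvt t ht y).deriv, (hvy t ht y).gradient]
    exact neg_add_cancel _
  · simp [hw0]

theorem eventually_mul_le_nhdsGT_zero (c : ℝ) {b : ℝ} (hb : 0 < b) :
    ∀ᶠ ε in 𝓝[>] (0 : ℝ), c * ε ≤ b := by
  have h : Tendsto (fun ε : ℝ => c * ε) (𝓝[>] 0) (𝓝 0) := by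
    have h1 : Tendsto (fun ε : ℝ => c * ε) (𝓝 0) (𝓝 (c * 0)) := tendsto_id.const_mul c
    rw [mul_zero] at h1
    exact h1.mono_left nhdsWithin_le_nhds
  exact h.eventually (eventually_le_nhds hb)

theorem fderiv_apply_eq_deriv_add_inner_gradient {E : Type*} [NormedAddCommGroup E]
    [InnerProductSpace ℝ E] [CompleteSpace E] {φ : ℝ × E → ℝ} {z : ℝ × E}
    (hφ : DifferentiableAt ℝ φ z) (w : ℝ × E) :
    fderiv ℝ φ z w = deriv (fun τ => φ (τ, z.2)) z.1 * w.1 +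
      ⟪gradient (fun y => φ (z.1, y)) z.2, w.2⟫ := by
  have h1 : HasFDerivAt (fun τ => φ (τ, z.2)) (fderiv ℝ φ z ∘L ContinuousLinearMap.inl ℝ ℝ E)
      z.1 := HasFDerivAt.comp (g := φ) z.1 hφ.hasFDerivAt (hasFDerivAt_prodMk_left z.1 z.2)
  have h2 : HasFDerivAt (fun y => φ (z.1, y)) (fderiv ℝ φ z ∘L ContinuousLinearMap.inr ℝ ℝ E)
      z.2 := HasFDerivAt.comp (g := φ) z.2 hφ.hasFDerivAt (hasFDerivAt_prodMk_right z.1 z.2)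
  rw [h1.hasDerivAt.deriv, h2.hasGradientAt.gradient]
  have h3 : w = w.1 • ((1 : ℝ), (0 : E)) + (0, w.2) := by simp
  conv_lhs => rw [h3]
  rw [map_add, map_smul]
  simp [mul_comm]

theorem exists_le_of_isLocalMax_sub {E : Type*} [NormedAddCommGroup E] [NormedSpace ℝ E]
    {U φ : ℝ × E → ℝ} {z : ℝ × E} (hφ : DifferentiableAt ℝ φ z)
    (hmax : IsLocalMax (fun w => U w - φ w) z) {ε : ℝ} (hε : 0 < ε) :
    ∃ ρ > 0, ∀ s y, |s| < ρ → ‖y‖ < ρ →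
      U (z.1 + s, z.2 + y) ≤ U z + fderiv ℝ φ z (s, y) + ε * (|s| + ‖y‖) := by
  have h := hmax.and (hφ.hasFDerivAt.isLittleO.def hε)
  obtain ⟨ρ, hρ, hb⟩ := Metric.eventually_nhds_iff.1 h
  refine ⟨ρ, hρ, fun s y hs hy => ?_⟩
  have hz : (z.1 + s, z.2 + y) - z = (s, y) := by ext <;> simp
  obtain ⟨h1, h2⟩ := @hb (z.1 + s, z.2 + y) (by
    rw [dist_eq_norm, hz]
    exact max_lt hs hy)
  rw [hz] at h2
  have h3 : ‖(s, y)‖ ≤ |s| + ‖y‖ := by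
    rw [Prod.norm_mk, Real.norm_eq_abs]
    exact max_le_add_of_nonneg (abs_nonneg s) (norm_nonneg y)
  have h4 := (Real.le_norm_self _).trans h2
  have h5 := mul_le_mul_of_nonneg_left h3 hε.le
  simp only at h1
  linarith

theorem le_quadratic_of_local_bound {E : Type*} [NormedAddCommGroup E] [InnerProductSpace ℝ E]
    {f : E → ℝ} {Q p : E} {B δ ε ρ k : ℝ} (hδ : 0 < δ) (hε : 0 < ε) (hρ : 0 < ρ)
    (hk0 : 0 ≤ k) (hloc : ∀ y, ‖y‖ < ρ → f (Q + y) ≤ B + ⟪p, y⟫ + ε * (δ + ‖y‖))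
    (hk : ∀ q, f q - f Q ≤ k * (1 + ‖q - Q‖))
    (hδK : 16 * (k / ρ + k + ‖p‖) / ρ * δ ≤ ε) (q : E) :
    f q ≤ B + 5 * ε * δ + ⟪p, q - Q⟫ + ε / (8 * δ) / 2 * ‖q - Q‖ ^ 2 := by
  set n := ‖q - Q‖ with hn
  have hn0 : 0 ≤ n := norm_nonneg _
  rcases lt_or_ge n ρ with h | h
  · have h1 := hloc (q - Q) h
    rw [add_sub_cancel, ← hn] at h1
    have h2 : ε * n ≤ 4 * ε * δ + ε / (8 * δ) / 2 * n ^ 2 := by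
      have : 4 * ε * δ + ε / (8 * δ) / 2 * n ^ 2 - ε * n = ε * (8 * δ - n) ^ 2 / (16 * δ) := by
        field_simp
        ring
      have h3 : 0 ≤ ε * (8 * δ - n) ^ 2 / (16 * δ) := by positivity
      linarith
    linarith
  · have h1 := hloc 0 (by simpa using hρ)
    simp only [add_zero, inner_zero_right, norm_zero] at h1
    have h2 := hk q
    have h3 : -(‖p‖ * n) ≤ ⟪p, q - Q⟫ := neg_le_of_abs_le (abs_real_inner_le_norm _ _)
    have h4 : k ≤ k / ρ * n := by
      rw [div_mul_eq_mul_div, le_div_iff₀ hρ]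
      exact mul_le_mul_of_nonneg_left h hk0
    have h5 : k / ρ + k + ‖p‖ ≤ ε / (8 * δ) / 2 * ρ := by
      rw [div_mul_eq_mul_div, div_le_iff₀ hρ] at hδK
      rw [div_div, div_mul_eq_mul_div, le_div_iff₀ (by positivity)]
      linarith
    have h6 : ε / (8 * δ) / 2 * ρ * n ≤ ε / (8 * δ) / 2 * n ^ 2 := by
      rw [sq, ← mul_assoc]
      gcongr
    have h7 := mul_le_mul_of_nonneg_right h5 hn0
    have h8 : 0 < ε * δ := by positivity
    linarith

/-- A function which is dominated at later times by every `C²` solution of the Hamilton–Jacobi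
equation dominating it at some time satisfies the viscosity sub-solution property. -/
theorem deriv_add_le_zero_of_isLocalMax {E : Type*} [NormedAddCommGroup E] [InnerProductSpace ℝ E]
    [CompleteSpace E] {h : ℝ × E × E → ℝ} {M : ℝ} (hh : ContDiff ℝ 2 h) (hM0 : 0 ≤ M)
    (hd : ∀ x y, ‖fderiv ℝ h x - fderiv ℝ h y‖ ≤ M * ‖x - y‖) {u : ℝ → E → ℝ}
    (hdom : ∀ (a b : ℝ) (v : ℝ × E → ℝ), ContDiffOn ℝ 2 v (Ioo a b ×ˢ univ) →
      (∀ t ∈ Ioo a b, ∀ y,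
        deriv (fun σ => v (σ, y)) t + h (t, y, gradient (fun y' => v (t, y')) y) = 0) →
      ∀ τ t : ℝ, 0 ≤ τ → a < τ → τ < t → t < b →
        (∀ q, u τ q ≤ v (τ, q)) → ∀ q, u t q ≤ v (t, q))
    (hk : ∀ T', 0 ≤ T' → ∃ k : ℝ, ∀ t ∈ Icc 0 T', ∀ q q', u t q' - u t q ≤ k * (1 + ‖q' - q‖))
    {φ : ℝ × E → ℝ} {z : ℝ × E} (hφ : DifferentiableAt ℝ φ z) (hz : 0 < z.1)
    (hmax : IsLocalMax (fun w : ℝ × E => u w.1 w.2 - φ w) z) :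
    deriv (fun τ => φ (τ, z.2)) z.1 + h (z.1, z.2, gradient (fun y => φ (z.1, y)) z.2) ≤ 0 := by
  obtain ⟨T, Q⟩ := z
  set c := deriv (fun τ => φ (τ, Q)) T with hc
  set p := gradient (fun y => φ (T, y)) Q with hp
  change c + h (T, Q, p) ≤ 0
  by_contra! hpos
  set η := c + h (T, Q, p) with hη
  have hη4 : 0 < η / 4 := by positivity
  obtain ⟨ρ₁, hρ₁, hcont⟩ := Metric.continuous_iff.1 hh.continuous (T, Q, p) (η / 4) hη4
  set C := ‖fderiv ℝ h (T, Q, p)‖ + M with hCdef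
  have hC : 0 ≤ C := by positivity
  obtain ⟨ε, ⟨⟨⟨hε1, hε2⟩, hε3⟩, hε⟩⟩ := (((((eventually_mul_le_nhdsGT_zero (2 * M) one_pos).and
    (eventually_mul_le_nhdsGT_zero 5 hη4)).and
    (eventually_mul_le_nhdsGT_zero (4 * C) (half_pos hρ₁))).and
      self_mem_nhdsWithin).exists)
  obtain ⟨ρ, hρ, hloc⟩ := exists_le_of_isLocalMax_sub (U := fun w => u w.1 w.2) hφ hmax hε
  simp only [fderiv_apply_eq_deriv_add_inner_gradient hφ] at hloc
  rw [← hc, ← hp] at hloc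
  obtain ⟨k, hk⟩ := hk T hz.le
  have hk0 : 0 ≤ k := by simpa using hk T ⟨hz.le, le_rfl⟩ Q Q
  obtain ⟨δ, ⟨⟨⟨⟨⟨⟨hδT, hδρ⟩, hδρ₁⟩, hδ1⟩, hδε⟩, hδK⟩, hδ⟩⟩ :=
    (((((((eventually_mul_le_nhdsGT_zero 1 hz).and
    (eventually_mul_le_nhdsGT_zero 1 (half_pos hρ))).and
    (eventually_mul_le_nhdsGT_zero 1 (half_pos hρ₁))).and
    (eventually_mul_le_nhdsGT_zero 3 one_pos)).and
    (eventually_mul_le_nhdsGT_zero 4 hε)).and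
    (eventually_mul_le_nhdsGT_zero (16 * (k / ρ + k + ‖p‖) / ρ) hε)).and
    self_mem_nhdsWithin).exists
  rw [one_mul] at hδT hδρ hδρ₁
  obtain ⟨v, hv2, hvsol, hv0, hvd⟩ := exists_local_solution (K := ε / (8 * δ)) (lam := ε⁻¹)
    (r := 2 * δ) (S := T - δ) (Q := Q) (p := p) hh hM0 hd (by positivity) (by positivity)
    (by
      rw [← div_eq_mul_inv, div_le_one hε]
      linarith)
    (by
      rw [← one_div, le_div_iff₀ hε]
      exact hε1)
    (by positivity) (by
      apply le_of_eq
      field_simp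
      norm_num) hC (fun s hs => by
      have h1 := hd (T - δ + s, Q, p) (T, Q, p)
      have h2 : ‖((T - δ + s, Q, p) : ℝ × E × E) - (T, Q, p)‖ ≤ 1 := by
        obtain ⟨h3, h4⟩ := abs_le.1 hs
        rw [Prod.mk_sub_mk, sub_self]
        exact norm_prod_le_iff.2 ⟨abs_le.2 ⟨by linarith, by linarith⟩, by simp⟩
      have h3 := mul_le_mul_of_nonneg_left h2 hM0
      have h4 := norm_le_norm_add_norm_sub' (fderiv ℝ h (T - δ + s, Q, p)) (fderiv ℝ h (T, Q, p))
      linarith) (u T Q - c * δ + 5 * ε * δ)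
  have hinit : ∀ q, u (T - δ) q ≤ v (T - δ, q) := fun q => by
    rw [hv0]
    refine le_quadratic_of_local_bound hδ hε hρ hk0 (fun y hy => ?_)
      (fun q => hk _ ⟨by linarith, by linarith⟩ Q q) hδK q
    have h1 := hloc (-δ) y (by rw [abs_neg, abs_of_pos hδ]; linarith) hy
    rw [abs_neg, abs_of_pos hδ] at h1
    simp only [← sub_eq_add_neg] at h1
    linarith
  have hTv := hdom _ _ v hv2 hvsol (T - δ) T (by linarith) (by linarith) (by linarith)
    (by linarith) hinit Q
  choose! π hπ hvd using hvd
  have hI : ∀ t ∈ Icc (T - δ) T, t ∈ Ioo (T - δ - 2 * δ) (T - δ + 2 * δ) := fun t ht =>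
    ⟨by linarith [ht.1], by linarith [ht.2]⟩
  obtain ⟨t, ht, hslope⟩ := exists_hasDerivAt_eq_slope (fun σ => v (σ, Q))
    (fun t => -h (t, Q, p + π t)) (sub_lt_self T hδ)
    (fun t ht => (hvd t (hI t ht)).continuousAt.continuousWithinAt)
    fun t ht => hvd t (hI t (Ioo_subset_Icc_self ht))
  have hnear : dist (t, Q, p + π t) (T, Q, p) < ρ₁ := by
    have h1 := hπ t (hI t (Ioo_subset_Icc_self ht))
    rw [inv_inv] at h1
    have h2 : ‖π t‖ < ρ₁ := by nlinarith
    have h3 : |t - T| < ρ₁ := abs_lt.2 ⟨by linarith [ht.1], by linarith [ht.2]⟩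
    rw [dist_eq_norm, Prod.mk_sub_mk, Prod.mk_sub_mk, sub_self, add_sub_cancel_left]
    simpa [hρ₁] using And.intro h3 h2
  have hh1 := (abs_lt.1 (hcont _ hnear)).1
  rw [hv0, eq_div_iff (by linarith)] at hslope
  simp only [sub_self, inner_zero_right, norm_zero] at hslope
  have hfin : (h (t, Q, p + π t) + c - 5 * ε) * δ ≤ 0 := by linarith
  have : 0 < h (t, Q, p + π t) + c - 5 * ε := by linarith
  nlinarith

theorem norm_fderiv_sub_le_of_norm_iteratedFDeriv_two_le {F : Type*} [NormedAddCommGroup F]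
    [NormedSpace ℝ F] {h : F → ℝ} {M : ℝ} (hh : ContDiff ℝ 2 h)
    (hM : ∀ x, ‖iteratedFDeriv ℝ 2 h x‖ ≤ M) (x y : F) :
    ‖fderiv ℝ h x - fderiv ℝ h y‖ ≤ M * ‖x - y‖ := by
  have h1 : ContDiff ℝ 1 (fderiv ℝ h) := hh.fderiv_right (by norm_num [one_add_one_eq_two])
  refine Convex.norm_image_sub_le_of_norm_fderiv_le (𝕜 := ℝ) (s := univ)
    (fun x _ => h1.differentiable one_ne_zero x) (fun x _ => ?_) convex_univ
    (mem_univ y) (mem_univ x)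
  rw [← norm_iteratedFDeriv_one, norm_iteratedFDeriv_fderiv]
  exact hM x

theorem gradient_fun_neg {E : Type*} [NormedAddCommGroup E] [InnerProductSpace ℝ E]
    [CompleteSpace E] (f : E → ℝ) (x : E) :
    gradient (fun y => -f y) x = -gradient f x := by
  simp [gradient, fderiv_fun_neg]

theorem norm_fderiv_neg_comp_sub_le {F : Type*} [NormedAddCommGroup F] [NormedSpace ℝ F]
    {h : F → ℝ} {M : ℝ} (hM0 : 0 ≤ M) (hh : Differentiable ℝ h)
    (hd : ∀ x y, ‖fderiv ℝ h x - fderiv ℝ h y‖ ≤ M * ‖x - y‖)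
    {L : F →L[ℝ] F} (hL : ‖L‖ ≤ 1) (x y : F) :
    ‖fderiv ℝ (fun x => -h (L x)) x - fderiv ℝ (fun x => -h (L x)) y‖ ≤ M * ‖x - y‖ := by
  have h1 : ∀ x, fderiv ℝ (fun x => -h (L x)) x = -(fderiv ℝ h (L x) ∘L L) := fun x =>
    (HasFDerivAt.comp x (hh (L x)).hasFDerivAt L.hasFDerivAt).fun_neg.fderiv
  rw [h1, h1, neg_sub_neg, ← ContinuousLinearMap.sub_comp]
  calc ‖(fderiv ℝ h (L y) - fderiv ℝ h (L x)) ∘L L‖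
      ≤ ‖fderiv ℝ h (L y) - fderiv ℝ h (L x)‖ * ‖L‖ := ContinuousLinearMap.opNorm_comp_le _ _
    _ ≤ M * ‖L (y - x)‖ * 1 := by
        rw [map_sub]
        exact mul_le_mul (hd _ _) hL (norm_nonneg _) (by positivity)
    _ ≤ M * ‖x - y‖ := by
        rw [mul_one, norm_sub_rev x y]
        exact mul_le_mul_of_nonneg_left
          ((L.le_opNorm _).trans (mul_le_of_le_one_left (norm_nonneg _) hL)) hM0

end

/-- If a family of operators `T_τ^t` (for `0 ≤ τ ≤ t`) satisfies the Markov
property, monotony, compatibility with the Hamilton–Jacobi equation, and boundedness, then for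
every initial condition `u₀` which is Lipschitz in the large, `u(t,q) := (T_0^t u₀)(q)` is a
viscosity solution of the Hamilton–Jacobi equation on `(0,∞) × ℝᵈ`. -/
theorem axiomatic_operators_give_viscosity_solutions {d : ℕ}
    (H : ℝ → EuclideanSpace ℝ (Fin d) → EuclideanSpace ℝ (Fin d) → ℝ)
    (hH : ContDiff ℝ 2 (fun x : ℝ × EuclideanSpace ℝ (Fin d) × EuclideanSpace ℝ (Fin d) =>
      H x.1 x.2.1 x.2.2))
    (M : ℝ)
    -- Hypothesis 1: `‖d²H‖ ≤ M`
    (hd2H : ∀ x : ℝ × EuclideanSpace ℝ (Fin d) × EuclideanSpace ℝ (Fin d),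
      ‖iteratedFDeriv ℝ 2
        (fun y : ℝ × EuclideanSpace ℝ (Fin d) × EuclideanSpace ℝ (Fin d) =>
          H y.1 y.2.1 y.2.2) x‖ ≤ M)
    -- the family of operators
    (T : ℝ → ℝ → (EuclideanSpace ℝ (Fin d) → ℝ) → EuclideanSpace ℝ (Fin d) → ℝ)
    -- Markov property
    (hMarkov : ∀ τ s t : ℝ, 0 ≤ τ → τ ≤ s → s ≤ t →
      ∀ u : EuclideanSpace ℝ (Fin d) → ℝ, T s t (T τ s u) = T τ t u)
    -- Monotony
    (hMono : ∀ τ t : ℝ, 0 ≤ τ → τ ≤ t →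
      ∀ u v : EuclideanSpace ℝ (Fin d) → ℝ, (∀ q, v q ≤ u q) →
        ∀ q, T τ t v q ≤ T τ t u q)
    -- Compatibility with (HJ): on `C²` solutions, `T_τ^t v_τ = v_t`
    (hCompat : ∀ (a b : ℝ) (v : ℝ × EuclideanSpace ℝ (Fin d) → ℝ),
      ContDiffOn ℝ 2 v (Ioo a b ×ˢ (univ : Set (EuclideanSpace ℝ (Fin d)))) →
      (∀ t ∈ Ioo a b, ∀ y : EuclideanSpace ℝ (Fin d),
        deriv (fun σ => v (σ, y)) t + H t y (gradient (fun y' => v (t, y')) y) = 0) →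
      ∀ τ t : ℝ, 0 ≤ τ → a < τ → τ < t → t < b →
        T τ t (fun q => v (τ, q)) = fun q => v (t, q))
    -- Boundedness: if `u_τ` is Lipschitz in the large, the `T_τ^t u_τ`, `t ∈ [τ, T']`,
    -- are uniformly Lipschitz in the large
    (hBound : ∀ (τ : ℝ), 0 ≤ τ → ∀ u : EuclideanSpace ℝ (Fin d) → ℝ,
      (∃ k : ℝ, ∀ q q', u q' - u q ≤ k * (1 + ‖q' - q‖)) →
      ∀ T' : ℝ, τ ≤ T' → ∃ k : ℝ, ∀ t ∈ Icc τ T', ∀ q q',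
        T τ t u q' - T τ t u q ≤ k * (1 + ‖q' - q‖))
    -- the initial condition, Lipschitz in the large
    (u₀ : EuclideanSpace ℝ (Fin d) → ℝ)
    (hu₀ : ∃ k : ℝ, ∀ q q', u₀ q' - u₀ q ≤ k * (1 + ‖q' - q‖)) :
    -- conclusion: `u(t,q) := T_0^t u₀ (q)` is a viscosity solution on `(0,∞) × ℝᵈ`
    (∀ φ : ℝ × EuclideanSpace ℝ (Fin d) → ℝ, ContDiff ℝ 1 φ →
      ∀ z : ℝ × EuclideanSpace ℝ (Fin d), 0 < z.1 →
        IsLocalMax (fun w : ℝ × EuclideanSpace ℝ (Fin d) => T 0 w.1 u₀ w.2 - φ w) z →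
        deriv (fun τ => φ (τ, z.2)) z.1 +
          H z.1 z.2 (gradient (fun y => φ (z.1, y)) z.2) ≤ 0) ∧
    (∀ φ : ℝ × EuclideanSpace ℝ (Fin d) → ℝ, ContDiff ℝ 1 φ →
      ∀ z : ℝ × EuclideanSpace ℝ (Fin d), 0 < z.1 →
        IsLocalMin (fun w : ℝ × EuclideanSpace ℝ (Fin d) => T 0 w.1 u₀ w.2 - φ w) z →
        0 ≤ deriv (fun τ => φ (τ, z.2)) z.1 +
          H z.1 z.2 (gradient (fun y => φ (z.1, y)) z.2)) := by
  set h : ℝ × EuclideanSpace ℝ (Fin d) × EuclideanSpace ℝ (Fin d) → ℝ :=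
    fun x => H x.1 x.2.1 x.2.2 with hh
  have hM0 : 0 ≤ M := (norm_nonneg _).trans (hd2H 0)
  have hd := norm_fderiv_sub_le_of_norm_iteratedFDeriv_two_le hH hd2H
  have hevol : ∀ τ t : ℝ, 0 ≤ τ → τ ≤ t → T τ t (T 0 τ u₀) = T 0 t u₀ := fun τ t h0 ht =>
    hMarkov 0 τ t le_rfl h0 ht u₀
  refine ⟨fun φ hφ z hz hmax => ?_, fun φ hφ z hz hmin => ?_⟩
  · refine deriv_add_le_zero_of_isLocalMax (u := fun t => T 0 t u₀) hH hM0 hd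
      (fun a b v hv hsol τ t h0 ha hτt hb hle q => ?_) (hBound 0 le_rfl u₀ hu₀)
      (hφ.differentiable one_ne_zero z) hz hmax
    have h1 := hMono τ t h0 hτt.le _ _ hle q
    rwa [hevol τ t h0 hτt.le, hCompat a b v hv hsol τ t h0 ha hτt hb] at h1
  · set L : ℝ × EuclideanSpace ℝ (Fin d) × EuclideanSpace ℝ (Fin d) →L[ℝ]
        ℝ × EuclideanSpace ℝ (Fin d) × EuclideanSpace ℝ (Fin d) :=
      (ContinuousLinearMap.id ℝ ℝ).prodMap ((ContinuousLinearMap.id ℝ _).prodMap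
        (-ContinuousLinearMap.id ℝ _)) with hL
    have hL1 : ‖L‖ ≤ 1 := ContinuousLinearMap.opNorm_le_bound _ zero_le_one fun x => by
      simp [hL, Prod.norm_def]
    have hmax : IsLocalMax (fun w : ℝ × EuclideanSpace ℝ (Fin d) =>
        -T 0 w.1 u₀ w.2 - -φ w) z := by
      refine hmin.neg.congr (Filter.Eventually.of_forall fun w => ?_)
      simp only
      ring
    have key := deriv_add_le_zero_of_isLocalMax (h := fun x => -h (L x))
      (u := fun t q => -T 0 t u₀ q) (φ := fun w => -φ w) (hH.comp L.contDiff).neg hM0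
      (norm_fderiv_neg_comp_sub_le hM0 (hH.differentiable two_ne_zero) hd hL1)
      (fun a b v hv hsol τ t h0 ha hτt hb hle q => ?_) (fun T' hT' => ?_)
      (hφ.differentiable one_ne_zero z).fun_neg hz hmax
    · rw [gradient_fun_neg, deriv.fun_neg] at key
      simp [hL, hh] at key
      linarith
    · have h1 := hMono τ t h0 hτt.le (T 0 τ u₀) (fun q => -v (τ, q))
        (fun q => by linarith [hle q]) q
      have h2 := hCompat a b (fun w => -v w) hv.neg (fun s hs y => by
        have h3 := hsol s hs y
        simp [hL, hh] at h3
        rw [gradient_fun_neg, deriv.fun_neg]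
        linarith) τ t h0 ha hτt hb
      rw [hevol τ t h0 hτt.le, h2] at h1
      linarith
    · obtain ⟨k, hk⟩ := hBound 0 le_rfl u₀ hu₀ T' hT'
      refine ⟨k, fun t ht q q' => ?_⟩
      have h1 := hk t ht q' q
      rw [norm_sub_rev] at h1
      linarith
end

section
/- Let H(q,p) : ℝ^d × ℝ^d → ℝ be a C² autonomous Hamiltonian satisfying: ‖d²H‖ ≤ M everywhere; ∂²_{pp} H ≥ m·Id in the sense of quadratic forms everywhere; and (m/2)|p|² − M ≤ H(q,p) ≤ (M/2)|p|² + M everywhere, with constants 0 < m ≤ M. Then for a function u : ℝ^d → ℝ and a real number a, the following are equivalent: (1) u is Lipschitz and H(q, du(q)) ≤ a for almost every q; (2) u is continuous and is a viscosity sub-solution of H(q, du(q)) = a, i.e. for every C¹ function φ and every point q at which u − φ attains a local maximum, H(q, dφ(q)) ≤ a; (3) u is Lipschitz and H(q, du(q)) ≤ a at every point q where u is differentiable. -/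
open scoped RealInnerProductSpace NNReal
open Set MeasureTheory

section

open Filter Topology Metric

variable {E : Type*} [NormedAddCommGroup E] [InnerProductSpace ℝ E]

lemma add_fderiv_sub_le_of_iteratedFDeriv_two_nonneg {F : Type*} [NormedAddCommGroup F]
    [NormedSpace ℝ F] {h : F → ℝ} (hh : ContDiff ℝ 2 h)
    (h2 : ∀ p v, 0 ≤ iteratedFDeriv ℝ 2 h p ![v, v]) (x y : F) :
    h x + fderiv ℝ h x (y - x) ≤ h y := by
  have hl : ∀ t : ℝ, HasDerivAt (fun s : ℝ => x + s • (y - x)) (y - x) t := fun t => by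
    simpa using ((hasDerivAt_id t).smul_const (y - x)).const_add x
  have hd1 : ∀ t : ℝ, HasDerivAt (fun s : ℝ => h (x + s • (y - x)))
      (fderiv ℝ h (x + t • (y - x)) (y - x)) t := fun t =>
    ((hh.differentiable (by norm_num)) _).hasFDerivAt.comp_hasDerivAt t (hl t)
  have hd2 : ∀ t : ℝ, HasDerivAt (fun s : ℝ => fderiv ℝ h (x + s • (y - x)) (y - x))
      (fderiv ℝ (fderiv ℝ h) (x + t • (y - x)) (y - x) (y - x)) t := fun t => by
    have hf : Differentiable ℝ (fderiv ℝ h) :=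
      (hh.fderiv_right (m := 1) (by norm_num)).differentiable (by norm_num)
    exact ((hf _).hasFDerivAt.comp_hasDerivAt t (hl t)).clm_apply (hasDerivAt_const t (y - x))
      |>.congr_deriv (by simp)
  have hc : ConvexOn ℝ univ (fun s : ℝ => h (x + s • (y - x))) := by
    refine convexOn_of_hasDerivWithinAt2_nonneg convex_univ
      (fun t _ => (hd1 t).continuousAt.continuousWithinAt)
      (fun t _ => (hd1 t).hasDerivWithinAt) (fun t _ => (hd2 t).hasDerivWithinAt) fun t _ => ?_
    simpa [iteratedFDeriv_two_apply] using h2 (x + t • (y - x)) (y - x)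
  have := hc.le_slope_of_hasDerivAt (mem_univ 0) (mem_univ 1) zero_lt_one (hd1 0)
  simp only [slope_def_field, zero_smul, add_zero, one_smul, add_sub_cancel, sub_zero,
    div_one] at this
  linarith

lemma sub_le_mul_of_ae_deriv_le {f : ℝ → ℝ} {K : ℝ≥0} (hf : LipschitzWith K f) {c t : ℝ}
    (ht : 0 ≤ t) (h : ∀ᵐ s, s ∈ Icc 0 t → deriv f s ≤ c) : f t - f 0 ≤ t * c := by
  have hac : AbsolutelyContinuousOnInterval f 0 t :=
    hf.lipschitzOnWith.absolutelyContinuousOnInterval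
  rw [← hac.integral_deriv_eq_sub]
  calc ∫ s in (0)..t, deriv f s ≤ ∫ _ in (0)..t, c := by
        refine intervalIntegral.integral_mono_ae_restrict ht hac.intervalIntegrable_deriv
          intervalIntegrable_const ?_
        exact (ae_restrict_iff' measurableSet_Icc).2 h
    _ = t * c := by simp

lemma sub_le_mul_of_ae_fderiv_le [FiniteDimensional ℝ E] [MeasurableSpace E] [BorelSpace E]
    {u : E → ℝ} {K : ℝ≥0} (hu : LipschitzWith K u) {q v : E} {r c : ℝ}
    (h : ∀ᵐ x, x ∈ ball q r → DifferentiableAt ℝ u x ∧ fderiv ℝ u x v ≤ c)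
    {t : ℝ} (ht : 0 ≤ t) (htr : t * ‖v‖ < r / 2) : u q - u (q - t • v) ≤ t * c := by
  have hr : 0 < r := by nlinarith [norm_nonneg v, mul_nonneg ht (norm_nonneg v)]
  have hshift : ∀ᵐ x : E, ∀ᵐ s : ℝ, x + s • v ∈ ball q r →
      DifferentiableAt ℝ u (x + s • v) ∧ fderiv ℝ u (x + s • v) v ≤ c := by
    obtain ⟨S, hS, hSm, hS0⟩ := exists_measurable_superset_of_null (mem_ae_iff.1 h)
    have hm : Measurable fun z : E × ℝ => z.1 + z.2 • v := by fun_prop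
    have hcomm := Measure.ae_ae_comm (μ := (volume : Measure E)) (ν := (volume : Measure ℝ))
      (p := fun x s => x + s • v ∈ Sᶜ) (hm hSm.compl)
    have : ∀ᵐ x : E, ∀ᵐ s : ℝ, x + s • v ∈ Sᶜ := by
      refine hcomm.2 (Eventually.of_forall fun s => ?_)
      exact (measurePreserving_add_right volume (s • v)).quasiMeasurePreserving.ae
        (measure_eq_zero_iff_ae_notMem.1 hS0)
    filter_upwards [this] with x hx
    filter_upwards [hx] with s hs
    by_contra hcon
    exact hs (hS hcon)
  have hline : ∀ᵐ x : E, x ∈ ball (q - t • v) (r / 2) → u (x + t • v) - u x ≤ t * c := by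
    filter_upwards [hshift] with x hx hxb
    have hL : LipschitzWith (K * ‖v‖₊) fun s : ℝ => u (x + s • v) := by
      refine hu.comp (LipschitzWith.of_dist_le_mul fun a b => ?_)
      rw [dist_add_left, dist_eq_norm, ← sub_smul, norm_smul, dist_eq_norm, mul_comm]
      rfl
    have := sub_le_mul_of_ae_deriv_le hL (c := c) ht ?_
    · simpa using this
    filter_upwards [hx] with s hs hst
    have hmem : x + s • v ∈ ball q r := by
      rw [mem_ball, dist_eq_norm] at hxb ⊢
      calc ‖x + s • v - q‖ = ‖(x - (q - t • v)) + (s - t) • v‖ := by congr 1; module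
        _ ≤ ‖x - (q - t • v)‖ + |s - t| * ‖v‖ := by
          simpa [norm_smul] using norm_add_le (x - (q - t • v)) ((s - t) • v)
        _ < r := by
          have : |s - t| ≤ t := by rw [abs_le]; constructor <;> linarith [hst.1, hst.2]
          nlinarith [norm_nonneg v]
    have hl : HasDerivAt (fun s : ℝ => x + s • v) v s := by
      simpa using ((hasDerivAt_id s).smul_const v).const_add x
    exact ((hs hmem).1.hasFDerivAt.comp_hasDerivAt s hl).deriv.trans_le (hs hmem).2
  have hfreq : ∃ᶠ x in 𝓝 (q - t • v), u (x + t • v) - u x ≤ t * c := by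
    have hd := mem_closure_iff_frequently.1 (Measure.dense_of_ae hline (q - t • v))
    exact (hd.and_eventually (ball_mem_nhds _ (half_pos hr))).mono fun x hx => hx.1 hx.2
  have hcl : IsClosed {x | u (x + t • v) - u x ≤ t * c} :=
    isClosed_le (by have := hu.continuous; fun_prop) continuous_const
  simpa using hcl.mem_of_frequently_of_tendsto hfreq tendsto_id

lemma exists_le_add_norm_of_norm_gradient_le [FiniteDimensional ℝ E] {u : E → ℝ}
    (hu : Continuous u) {R : ℝ} (hR0 : 0 ≤ R)
    (hR : ∀ φ : E → ℝ, ContDiff ℝ 1 φ → ∀ q, IsLocalMax (fun y => u y - φ y) q →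
      ‖gradient φ q‖ ≤ R) (z : E) :
    ∃ B, 0 ≤ B ∧ ∀ y ∈ ball z 1,
      u y ≤ u z + 2 * (R + 1) * ‖y - z‖ + B * ‖y - z‖ ^ 2 := by
  obtain ⟨C, hC⟩ := (isCompact_closedBall z 1).exists_bound_of_continuousOn hu.continuousOn
  have hC' : ∀ y ∈ closedBall z 1, |u y| ≤ C := hC
  have hz := hC' z (by simp)
  have hC0 : 0 ≤ C := (abs_nonneg _).trans hz
  refine ⟨2 * C + 1, by positivity, fun y hy => le_of_forall_pos_le_add fun η hη => ?_⟩
  set B := 2 * C + 1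
  set K := 2 * (R + 1)
  obtain ⟨ε, hε, hεu⟩ := Metric.continuousAt_iff.1 (hu.continuousAt (x := z)) η hη
  replace hεu : ∀ w, ‖w - z‖ ≤ ε / 2 → u w < u z + η := fun w hw => by
    have := hεu (x := w) (by rw [dist_eq_norm]; linarith)
    rw [Real.dist_eq] at this
    linarith [le_abs_self (u w - u z)]
  set e := ε / 2
  have he : 0 < e := half_pos hε
  set φ : E → ℝ := fun y => K * √(e ^ 2 + ‖y - z‖ ^ 2) + B * ‖y - z‖ ^ 2
  have hpos : ∀ y, 0 < e ^ 2 + ‖y - z‖ ^ 2 := fun y => by positivity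
  have hφ : ContDiff ℝ 1 φ := by
    have hn : ContDiff ℝ 1 fun y : E => ‖y - z‖ ^ 2 := (contDiff_id.sub contDiff_const).norm_sq ℝ
    exact (contDiff_const.mul ((contDiff_const.add hn).sqrt fun y => (hpos y).ne')).add
      (contDiff_const.mul hn)
  have hgrad : ∀ w, fderiv ℝ φ w (w - z) =
      (K / √(e ^ 2 + ‖w - z‖ ^ 2) + 2 * B) * ‖w - z‖ ^ 2 := fun w => by
    have hn : HasFDerivAt (fun y : E => ‖y - z‖ ^ 2) (2 • (innerSL ℝ (w - z))) w := by
      simpa using ((hasFDerivAt_id w).sub_const z).norm_sq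
    have : HasFDerivAt φ _ w :=
      (((hn.const_add (e ^ 2)).sqrt (hpos w).ne').const_mul K).add (hn.const_mul B)
    rw [this.fderiv]
    have hs := (Real.sqrt_pos.2 (hpos w)).ne'
    simp [-map_sub]
    field_simp
  obtain ⟨w, hw, hmax⟩ := (isCompact_closedBall z 1).exists_isMaxOn ⟨z, by simp⟩
    (hu.sub hφ.continuous).continuousOn
  have hmax' : ∀ x ∈ closedBall z 1, u x - φ x ≤ u w - φ w := hmax
  have hKe : ∀ x, K * e ≤ K * √(e ^ 2 + ‖x - z‖ ^ 2) := fun x =>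
    mul_le_mul_of_nonneg_left (Real.le_sqrt_of_sq_le (by nlinarith [sq_nonneg ‖x - z‖]))
      (by positivity)
  have hφz : φ z = K * e := by simp [φ, Real.sqrt_sq he.le]
  have hw1 : ‖w - z‖ < 1 := by
    rw [mem_closedBall, dist_eq_norm] at hw
    refine lt_of_le_of_ne hw fun h1 => ?_
    have h2 := hmax' z (by simp)
    have h3 : φ w = K * √(e ^ 2 + ‖w - z‖ ^ 2) + B * ‖w - z‖ ^ 2 := rfl
    have h4 := hKe w
    have h5 := hC' w (by rw [mem_closedBall, dist_eq_norm]; exact hw)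
    rw [h1] at h3 h4
    have h6 := abs_le.1 hz
    have h7 := abs_le.1 h5
    simp only [B] at h3
    linarith
  have hloc : IsLocalMax (fun y => u y - φ y) w :=
    hmax.isLocalMax (closedBall_mem_nhds_of_mem (by rwa [mem_ball, dist_eq_norm]))
  have hwe : ‖w - z‖ ≤ e := by
    by_contra! hlt
    have hg := hR φ hφ w hloc
    have h1 : fderiv ℝ φ w (w - z) ≤ R * ‖w - z‖ := by
      rw [← inner_gradient_left]
      exact (real_inner_le_norm _ _).trans (by gcongr)
    rw [hgrad] at h1
    have hwp : 0 < ‖w - z‖ := he.trans hlt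
    have hs : √(e ^ 2 + ‖w - z‖ ^ 2) ≤ 2 * ‖w - z‖ := by
      rw [Real.sqrt_le_left (by positivity)]
      nlinarith
    have h2 : (R + 1) / ‖w - z‖ ≤ K / √(e ^ 2 + ‖w - z‖ ^ 2) := by
      rw [div_le_div_iff₀ hwp (Real.sqrt_pos.2 (hpos w))]
      simp only [K]
      nlinarith
    have h3 : (R + 1) * ‖w - z‖ ≤ K / √(e ^ 2 + ‖w - z‖ ^ 2) * ‖w - z‖ ^ 2 := by
      calc (R + 1) * ‖w - z‖ = (R + 1) / ‖w - z‖ * ‖w - z‖ ^ 2 := by field_simp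
        _ ≤ _ := by gcongr
    have h4 : 0 ≤ 2 * B * ‖w - z‖ ^ 2 := by positivity
    linarith
  have h1 := hmax' y (ball_subset_closedBall hy)
  have h2 := hεu w hwe
  have h3 : K * e ≤ φ w := (hKe w).trans (le_add_of_nonneg_right (by positivity))
  have h4 : φ y ≤ K * (e + ‖y - z‖) + B * ‖y - z‖ ^ 2 := by
    have : √(e ^ 2 + ‖y - z‖ ^ 2) ≤ e + ‖y - z‖ := by
      rw [Real.sqrt_le_left (by positivity)]
      nlinarith [mul_nonneg he.le (norm_nonneg (y - z))]
    simp only [φ]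
    gcongr
  linarith

lemma lipschitzWith_of_norm_gradient_le [FiniteDimensional ℝ E] {u : E → ℝ}
    (hu : Continuous u) {R : ℝ} (hR0 : 0 ≤ R)
    (hR : ∀ φ : E → ℝ, ContDiff ℝ 1 φ → ∀ q, IsLocalMax (fun y => u y - φ y) q →
      ‖gradient φ q‖ ≤ R) :
    LipschitzWith (2 * (R + 1)).toNNReal u := by
  refine LipschitzWith.of_le_add_mul' _ fun x y => ?_
  rw [dist_comm, dist_eq_norm]
  set v := x - y
  set L := 2 * (R + 1)
  have hL : 0 ≤ L := by positivity
  have key := image_le_of_liminf_slope_right_le_deriv_boundary (a := 0) (b := 1)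
    (f := fun t : ℝ => u (y + t • v)) (B := fun t => u y + t * (L * ‖v‖))
    (B' := fun _ => L * ‖v‖) (by fun_prop) (by simp) (by fun_prop)
    (fun t _ => by
      simpa using (((hasDerivAt_id t).mul_const (L * ‖v‖)).const_add (u y)).hasDerivWithinAt)
    (fun t _ r hr => ?_) (x := 1) (by simp)
  · rw [norm_sub_rev]
    simpa [v] using key
  obtain ⟨B, hB, hz⟩ := exists_le_add_norm_of_norm_gradient_le hu hR0 hR (y + t • v)
  refine Eventually.frequently ?_
  have c1 : ∀ᶠ s in 𝓝[>] t, y + s • v ∈ ball (y + t • v) 1 :=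
    (Continuous.tendsto (by fun_prop : Continuous fun s : ℝ => y + s • v) t).mono_left
      nhdsWithin_le_nhds (ball_mem_nhds _ one_pos)
  have c2 : ∀ᶠ s in 𝓝[>] t, L * ‖v‖ + B * ((s - t) * ‖v‖ ^ 2) < r := by
    refine (Tendsto.mono_left (Continuous.tendsto' (by fun_prop) t _ ?_)
      nhdsWithin_le_nhds).eventually_lt_const hr
    simp
  filter_upwards [c1, c2, self_mem_nhdsWithin] with s h1 h2 hs
  have hs' : 0 < s - t := sub_pos.2 hs
  rw [slope_def_field, div_lt_iff₀ hs']
  have h3 := hz _ h1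
  have h4 : y + s • v - (y + t • v) = (s - t) • v := by module
  rw [h4, norm_smul, Real.norm_of_nonneg hs'.le] at h3
  nlinarith

/-- At a point of differentiability of `u`, the gradient of `u` is a limit of gradients of `C¹`
functions touching `u` from above at nearby points. -/
lemma exists_isLocalMax_near_of_differentiableAt [FiniteDimensional ℝ E] {u : E → ℝ}
    (hu : Continuous u) {q : E} (hq : DifferentiableAt ℝ u q) {η : ℝ} (hη : 0 < η) :
    ∃ φ : E → ℝ, ContDiff ℝ 1 φ ∧ ∃ w, IsLocalMax (fun y => u y - φ y) w ∧
      ‖w - q‖ < η ∧ ‖gradient φ w - gradient u q‖ ≤ 4 * η := by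
  have hbig := hq.hasFDerivAt.isLittleO.def hη
  obtain ⟨ε, hε, hball⟩ := Metric.eventually_nhds_iff.1 hbig
  set r := min (ε / 2) (η / 2)
  have hr : 0 < r := by positivity
  have hrε : r < ε := (min_le_left _ _).trans_lt (by linarith)
  have hrη : r < η := (min_le_right _ _).trans_lt (by linarith)
  set ℓ := fderiv ℝ u q
  set φ : E → ℝ := fun y => ℓ y + 2 * η / r * ‖y - q‖ ^ 2
  have hφ : ContDiff ℝ 1 φ :=
    ℓ.contDiff.add (contDiff_const.mul ((contDiff_id.sub contDiff_const).norm_sq ℝ))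
  have hgrad : ∀ w, gradient φ w - gradient u q = (4 * η / r) • (w - q) := fun w => by
    refine ext_inner_right ℝ fun v => ?_
    have hn : HasFDerivAt (fun y : E => ‖y - q‖ ^ 2) (2 • (innerSL ℝ (w - q))) w := by
      simpa using ((hasFDerivAt_id w).sub_const q).norm_sq
    have : HasFDerivAt φ _ w := (ℓ.hasFDerivAt (x := w)).add (hn.const_mul (2 * η / r))
    rw [inner_sub_left, inner_gradient_left, inner_gradient_left, this.fderiv, inner_smul_left]
    simp [ℓ, inner_sub_left]
    ring
  obtain ⟨w, hw, hmax⟩ := (isCompact_closedBall q r).exists_isMaxOn ⟨q, by simp [hr.le]⟩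
    (hu.sub hφ.continuous).continuousOn
  rw [mem_closedBall, dist_eq_norm] at hw
  have hwr : ‖w - q‖ < r := by
    refine lt_of_le_of_ne hw fun h1 => ?_
    have h2 : u q - φ q ≤ u w - φ w := hmax (by simp [hr.le])
    have h3 := hball (y := w) (by rw [dist_eq_norm]; linarith)
    have h4 := (le_abs_self _).trans h3
    rw [h1, map_sub] at h4
    simp only [φ, h1, sub_self, norm_zero] at h2
    have h5 : 2 * η / r * r ^ 2 = 2 * (η * r) := by field_simp
    rw [h5] at h2
    have : 0 < η * r := by positivity
    simp only [ℓ] at h2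
    norm_num at h2
    linarith
  refine ⟨φ, hφ, w, hmax.isLocalMax (closedBall_mem_nhds_of_mem ?_), hwr.trans hrη, ?_⟩
  · rwa [mem_ball, dist_eq_norm]
  · rw [hgrad, norm_smul, Real.norm_of_nonneg (by positivity)]
    calc 4 * η / r * ‖w - q‖ ≤ 4 * η / r * r := by gcongr
      _ = 4 * η := by field_simp

lemma le_of_isLocalMax_of_differentiableAt [FiniteDimensional ℝ E] {H : E → E → ℝ}
    (hH : Continuous fun x : E × E => H x.1 x.2) {u : E → ℝ} {a : ℝ} (hu : Continuous u)
    (hv : ∀ φ : E → ℝ, ContDiff ℝ 1 φ → ∀ q, IsLocalMax (fun y => u y - φ y) q →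
      H q (gradient φ q) ≤ a)
    {q : E} (hq : DifferentiableAt ℝ u q) : H q (gradient u q) ≤ a := by
  have hcl : IsClosed {x : E × E | H x.1 x.2 ≤ a} := isClosed_le hH continuous_const
  suffices h : (q, gradient u q) ∈ closure {x : E × E | H x.1 x.2 ≤ a} by
    rwa [hcl.closure_eq] at h
  refine Metric.mem_closure_iff.2 fun ε hε => ?_
  obtain ⟨φ, hφ, w, hw, h1, h2⟩ :=
    exists_isLocalMax_near_of_differentiableAt hu hq (η := ε / 8) (by positivity)
  refine ⟨(w, gradient φ w), hv φ hφ w hw, ?_⟩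
  rw [dist_comm, Prod.dist_eq, dist_eq_norm, dist_eq_norm]
  exact max_lt (by linarith) (by linarith)

lemma le_of_ae_le_of_isLocalMax [FiniteDimensional ℝ E] [MeasurableSpace E] [BorelSpace E]
    {H : E → E → ℝ} (hH : ContDiff ℝ 2 fun x : E × E => H x.1 x.2)
    (hconv : ∀ q p v, 0 ≤ iteratedFDeriv ℝ 2 (H q) p ![v, v])
    {u : E → ℝ} {K : ℝ≥0} (hu : LipschitzWith K u) {a : ℝ}
    (hae : ∀ᵐ q, DifferentiableAt ℝ u q ∧ H q (gradient u q) ≤ a)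
    {φ : E → ℝ} {q : E} (hφ : DifferentiableAt ℝ φ q)
    (hmax : IsLocalMax (fun y => u y - φ y) q) : H q (gradient φ q) ≤ a := by
  by_contra! hlt
  set p := gradient φ q
  set G : E → E →L[ℝ] ℝ := fun x =>
    (fderiv ℝ (fun x : E × E => H x.1 x.2) (x, p)).comp (ContinuousLinearMap.inr ℝ E E)
  have hG : Continuous G := by
    have := hH.continuous_fderiv (by norm_num)
    exact (this.comp (by fun_prop : Continuous fun x : E => (x, p))).clm_comp continuous_const
  have hGH : ∀ x y, H x p + G x (y - p) ≤ H x y := fun x y => by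
    have h1 : ContDiff ℝ 2 (H x) := hH.comp (contDiff_prodMk_right x)
    have h2 : fderiv ℝ (H x) p = G x :=
      ((hH.differentiable (by norm_num) (x, p)).hasFDerivAt.comp p
        (hasFDerivAt_prodMk_right x p)).fderiv
    rw [← h2]
    exact add_fderiv_sub_le_of_iteratedFDeriv_two_nonneg h1 (hconv x) p y
  set v := (InnerProductSpace.toDual ℝ E).symm (G q)
  have hv : ∀ y, ⟪y, v⟫ = G q y := fun y => by
    rw [real_inner_comm]; exact InnerProductSpace.toDual_symm_apply
  set δ := (H q p - a) / 2
  have hδ : 0 < δ := half_pos (sub_pos.2 hlt)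
  have hnear : ∀ᶠ x in 𝓝 q, a - H x p + ‖G x - G q‖ * (K + ‖p‖) < -δ := by
    have hHp : Continuous fun x => H x p :=
      hH.continuous.comp (by fun_prop : Continuous fun x : E => (x, p))
    have hc : Continuous fun x => a - H x p + ‖G x - G q‖ * (K + ‖p‖) := by fun_prop
    exact (hc.tendsto' q (a - H q p) (by simp)).eventually_lt_const
      (by simp only [δ]; linarith)
  obtain ⟨r, hr, hball⟩ := Metric.eventually_nhds_iff_ball.1 hnear
  have hae' : ∀ᵐ x, x ∈ ball q r → DifferentiableAt ℝ u x ∧ fderiv ℝ u x v ≤ ⟪p, v⟫ - δ := by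
    filter_upwards [hae] with x ⟨hx, hxa⟩ hxb
    refine ⟨hx, ?_⟩
    have h1 := hGH x (gradient u x)
    have h2 := hball x hxb
    have h3 : ‖gradient u x‖ ≤ K := by
      rw [gradient, LinearIsometryEquiv.norm_map]
      exact norm_fderiv_le_of_lipschitz ℝ hu
    have h4 : -((G x - G q) (gradient u x - p)) ≤ ‖G x - G q‖ * (K + ‖p‖) := by
      refine (neg_le_abs _).trans (((G x - G q).le_opNorm _).trans ?_)
      gcongr
      exact (norm_sub_le _ _).trans (by gcongr)
    rw [← inner_gradient_left, hv, hv]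
    simp only [sub_apply, map_sub] at h1 h4
    simp at h4
    linarith
  have hφd : HasDerivAt (fun t : ℝ => φ (q - t • v)) (-⟪p, v⟫) 0 := by
    have hl : HasDerivAt (fun t : ℝ => q - t • v) (-v) 0 := by
      simpa using ((hasDerivAt_id (0 : ℝ)).smul_const v).const_sub q
    have hφ' : HasFDerivAt φ (fderiv ℝ φ q) (q - (0 : ℝ) • v) := by simpa using hφ.hasFDerivAt
    refine (hφ'.comp_hasDerivAt 0 hl).congr_deriv ?_
    simp [p]
  have hlim := (hasDerivAt_iff_tendsto_slope.1 hφd).mono_left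
    (nhdsWithin_mono (0 : ℝ) (fun t (ht : t ∈ Ioi 0) => ht.ne'))
  have hge : -⟪p, v⟫ + δ ≤ -⟪p, v⟫ := by
    refine ge_of_tendsto hlim ?_
    have c1 : ∀ᶠ t : ℝ in 𝓝[>] 0, u (q - t • v) - φ (q - t • v) ≤ u q - φ q :=
      (Continuous.tendsto' (by fun_prop : Continuous fun t : ℝ => q - t • v) 0 q
        (by simp)).mono_left nhdsWithin_le_nhds |>.eventually hmax
    have c2 : ∀ᶠ t : ℝ in 𝓝[>] 0, t * ‖v‖ < r / 2 :=
      ((Continuous.tendsto' (by fun_prop : Continuous fun t : ℝ => t * ‖v‖) 0 0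
        (by simp)).mono_left nhdsWithin_le_nhds).eventually_lt_const (half_pos hr)
    filter_upwards [c1, c2, self_mem_nhdsWithin] with t h1 h2 (ht : 0 < t)
    have h3 := sub_le_mul_of_ae_fderiv_le hu hae' ht.le h2
    rw [slope_def_field, le_div_iff₀ (by simpa using ht)]
    simp
    linarith
  linarith

end

/-- Equivalent characterizations of sub-solutions at level `a` for an
autonomous Tonelli Hamiltonian: (1) Lipschitz and `H(q, du(q)) ≤ a` almost everywhere;
(2) continuous viscosity sub-solution; (3) Lipschitz and `H(q, du(q)) ≤ a` at every point of
differentiability. -/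
theorem subsolution_characterizations {d : ℕ}
    (H : EuclideanSpace ℝ (Fin d) → EuclideanSpace ℝ (Fin d) → ℝ)
    (hH : ContDiff ℝ 2 (fun x : EuclideanSpace ℝ (Fin d) × EuclideanSpace ℝ (Fin d) =>
      H x.1 x.2))
    (m M : ℝ) (hm : 0 < m) (hmM : m ≤ M)
    -- Hypothesis 1: `‖d²H‖ ≤ M`
    (hd2H : ∀ x : EuclideanSpace ℝ (Fin d) × EuclideanSpace ℝ (Fin d),
      ‖iteratedFDeriv ℝ 2
        (fun y : EuclideanSpace ℝ (Fin d) × EuclideanSpace ℝ (Fin d) => H y.1 y.2) x‖ ≤ M)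
    -- Hypothesis 2: `∂²ₚₚH ≥ m·Id` in the sense of quadratic forms
    (hconv : ∀ q p v : EuclideanSpace ℝ (Fin d),
      m * ‖v‖ ^ 2 ≤ iteratedFDeriv ℝ 2 (fun p' => H q p') p ![v, v])
    -- Hypothesis 3
    (hlower : ∀ q p : EuclideanSpace ℝ (Fin d), m / 2 * ‖p‖ ^ 2 - M ≤ H q p)
    (hupper : ∀ q p : EuclideanSpace ℝ (Fin d), H q p ≤ M / 2 * ‖p‖ ^ 2 + M)
    (u : EuclideanSpace ℝ (Fin d) → ℝ) (a : ℝ) :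
    (((∃ K : ℝ≥0, LipschitzWith K u) ∧
        ∀ᵐ q : EuclideanSpace ℝ (Fin d) ∂volume,
          DifferentiableAt ℝ u q ∧ H q (gradient u q) ≤ a) ↔
      (Continuous u ∧
        ∀ φ : EuclideanSpace ℝ (Fin d) → ℝ, ContDiff ℝ 1 φ →
          ∀ q : EuclideanSpace ℝ (Fin d),
            IsLocalMax (fun y => u y - φ y) q → H q (gradient φ q) ≤ a)) ∧
    ((Continuous u ∧
        ∀ φ : EuclideanSpace ℝ (Fin d) → ℝ, ContDiff ℝ 1 φ →
          ∀ q : EuclideanSpace ℝ (Fin d),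
            IsLocalMax (fun y => u y - φ y) q → H q (gradient φ q) ≤ a) ↔
      ((∃ K : ℝ≥0, LipschitzWith K u) ∧
        ∀ q : EuclideanSpace ℝ (Fin d),
          DifferentiableAt ℝ u q → H q (gradient u q) ≤ a)) := by
  have hconv0 : ∀ q p v, 0 ≤ iteratedFDeriv ℝ 2 (H q) p ![v, v] := fun q p v =>
    (by positivity : 0 ≤ m * ‖v‖ ^ 2).trans (hconv q p v)
  have hbound : ∀ q p, H q p ≤ a → ‖p‖ ≤ √(2 * (a + M) / m) := fun q p h => by
    refine Real.le_sqrt_of_sq_le ?_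
    rw [le_div_iff₀ hm]
    linarith [hlower q p]
  have h12 : ((∃ K : ℝ≥0, LipschitzWith K u) ∧
      ∀ᵐ q : EuclideanSpace ℝ (Fin d) ∂volume,
        DifferentiableAt ℝ u q ∧ H q (gradient u q) ≤ a) →
      Continuous u ∧ ∀ φ : EuclideanSpace ℝ (Fin d) → ℝ, ContDiff ℝ 1 φ →
        ∀ q, IsLocalMax (fun y => u y - φ y) q → H q (gradient φ q) ≤ a := by
    rintro ⟨⟨K, hK⟩, hae⟩
    exact ⟨hK.continuous, fun φ hφ q hq => le_of_ae_le_of_isLocalMax hH hconv0 hK hae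
      (hφ.differentiable (by norm_num) q) hq⟩
  have h23 : (Continuous u ∧ ∀ φ : EuclideanSpace ℝ (Fin d) → ℝ, ContDiff ℝ 1 φ →
        ∀ q, IsLocalMax (fun y => u y - φ y) q → H q (gradient φ q) ≤ a) →
      (∃ K : ℝ≥0, LipschitzWith K u) ∧
        ∀ q, DifferentiableAt ℝ u q → H q (gradient u q) ≤ a := by
    rintro ⟨hu, hv⟩
    exact ⟨⟨_, lipschitzWith_of_norm_gradient_le hu (Real.sqrt_nonneg _)
      fun φ hφ q hq => hbound q _ (hv φ hφ q hq)⟩,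
      fun q hq => le_of_isLocalMax_of_differentiableAt hH.continuous hu hv hq⟩
  have h31 : ((∃ K : ℝ≥0, LipschitzWith K u) ∧
        ∀ q, DifferentiableAt ℝ u q → H q (gradient u q) ≤ a) →
      (∃ K : ℝ≥0, LipschitzWith K u) ∧ ∀ᵐ q : EuclideanSpace ℝ (Fin d) ∂volume,
        DifferentiableAt ℝ u q ∧ H q (gradient u q) ≤ a := by
    rintro ⟨⟨K, hK⟩, hd⟩
    exact ⟨⟨K, hK⟩, hK.ae_differentiableAt.mono fun q hq => ⟨hq, hd q hq⟩⟩
  exact ⟨⟨h12, fun h => h31 (h23 h)⟩, ⟨h23, fun h => h12 (h31 h)⟩⟩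
end
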